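/- Let G be a 2-connected graph. If G is both K_{1,3}-f-heavy and P_6-f-heavy, then G is Hamiltonian. -/

import Mathlib

open SimpleGraph

/-- `G` contains a cycle of length `k`. -/
def HasCycleLength {V : Type} (G : SimpleGraph V) (k : ℕ) : Prop :=
  ∃ (v : V) (c : G.Walk v v), c.IsCycle ∧ c.length = k

/-- A graph on `n` vertices is pancyclic if it contains cycles of every length from 3 to `n`. -/
def IsPancyclic {V : Type} [Fintype V] (G : SimpleGraph V) : Prop :=
  ∀ k : ℕ, 3 ≤ k → k ≤ Fintype.card V → HasCycleLength G k

/-- A graph is Hamiltonian if it contains a spanning cycle. -/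
def IsHamiltonianGraph {V : Type} (G : SimpleGraph V) : Prop :=
  ∃ (v : V) (c : G.Walk v v), c.IsCycle ∧ ∀ u : V, u ∈ c.support

/-- A graph is 2-connected if it has at least 3 vertices and deleting any single
vertex leaves a connected graph. -/
def TwoConnected {V : Type} [Fintype V] (G : SimpleGraph V) : Prop :=
  3 ≤ Fintype.card V ∧ ∀ v : V, (G.induce {u : V | u ≠ v}).Connected

/-- A (finite) graph is a cycle iff it is connected and 2-regular. -/
def IsCycleGraph {V : Type} [Fintype V] (G : SimpleGraph V) [DecidableRel G.Adj] : Prop :=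
  G.Connected ∧ ∀ v : V, G.degree v = 2

/-- `G` is `R`-f₁-heavy: for every induced copy of `R` in `G` (given by a graph
embedding `f : R ↪g G`) and every pair of vertices at distance 2 in that copy,
one of them has degree at least `(n+1)/2` in `G`. -/
def F1Heavy {V W : Type} [Fintype V] (G : SimpleGraph V) [DecidableRel G.Adj]
    (R : SimpleGraph W) : Prop :=
  ∀ (f : R ↪g G) (a b : W), R.dist a b = 2 →
    Fintype.card V + 1 ≤ 2 * max (G.degree (f a)) (G.degree (f b))

/-- `G` is `R`-f-heavy: as above but with degree at least `n/2`. -/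
def FHeavy {V W : Type} [Fintype V] (G : SimpleGraph V) [DecidableRel G.Adj]
    (R : SimpleGraph W) : Prop :=
  ∀ (f : R ↪g G) (a b : W), R.dist a b = 2 →
    Fintype.card V ≤ 2 * max (G.degree (f a)) (G.degree (f b))

/-- `G` is `R`-free: no induced subgraph of `G` is isomorphic to `R`. -/
def RFree {V W : Type} (G : SimpleGraph V) (R : SimpleGraph W) : Prop :=
  IsEmpty (R ↪g G)

/-- The claw `K_{1,3}`: vertex `0` is the center, adjacent to `1`, `2`, `3`. -/
def claw : SimpleGraph (Fin 4) := SimpleGraph.fromRel (fun a _ => a = 0)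

/-- `Z_i`: the path `0 1 2 ... (i+2)` together with the chord `{0,2}`,
i.e. a triangle `0 1 2` with a path of `i` edges attached at vertex `2`. -/
def Zgraph (i : ℕ) : SimpleGraph (Fin (i + 3)) :=
  SimpleGraph.fromRel (fun a b => b.val = a.val + 1 ∨ (a.val = 0 ∧ b.val = 2))

/-- The net `N`: triangle `0 1 2` with pendant edges `0-3`, `1-4`, `2-5`. -/
def netGraph : SimpleGraph (Fin 6) :=
  SimpleGraph.fromRel (fun a b =>
    (a.val = 0 ∧ b.val = 1) ∨ (a.val = 1 ∧ b.val = 2) ∨ (a.val = 0 ∧ b.val = 2) ∨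
    (a.val = 0 ∧ b.val = 3) ∨ (a.val = 1 ∧ b.val = 4) ∨ (a.val = 2 ∧ b.val = 5))

/-- The wounded `W`: triangle `0 1 2` with a pendant edge `0-3` and a pendant
path `1-4-5` of two edges. -/
def woundedGraph : SimpleGraph (Fin 6) :=
  SimpleGraph.fromRel (fun a b =>
    (a.val = 0 ∧ b.val = 1) ∨ (a.val = 1 ∧ b.val = 2) ∨ (a.val = 0 ∧ b.val = 2) ∨
    (a.val = 0 ∧ b.val = 3) ∨ (a.val = 1 ∧ b.val = 4) ∨ (a.val = 4 ∧ b.val = 5))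


/-! ## Paths with prescribed vertex multiset -/

/-- There is a walk without repetition constraints whose vertex multiset is `M`, from `x` to `y`. -/
def Pth {V : Type} (G : SimpleGraph V) (M : Multiset V) (x y : V) : Prop :=
  ∃ l : List V, (l : Multiset V) = M ∧ l.IsChain G.Adj ∧ l.head? = some x ∧ l.getLast? = some y

theorem Pth.single {V : Type} (G : SimpleGraph V) (x : V) : Pth G {x} x x :=
  ⟨[x], by simp, by simp, by simp, by simp⟩

theorem Pth.append {V : Type} {G : SimpleGraph V} {M N : Multiset V} {x y z w : V}
    (h1 : Pth G M x y) (h2 : Pth G N z w) (h : G.Adj y z) : Pth G (M + N) x w := by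
  obtain ⟨l, rfl, hc, hh, hl⟩ := h1
  obtain ⟨l', rfl, hc', hh', hl'⟩ := h2
  refine ⟨l ++ l', by simp, ?_, ?_, ?_⟩
  · rw [List.isChain_append]
    refine ⟨hc, hc', ?_⟩
    intro a ha b hb
    rw [hl] at ha; rw [hh'] at hb
    simp at ha hb
    subst ha; subst hb; exact h
  · simp [List.head?_append, hh]
  · simp [List.getLast?_append, hl']

theorem Pth.symm {V : Type} {G : SimpleGraph V} {M : Multiset V} {x y : V}
    (h1 : Pth G M x y) : Pth G M y x := by
  obtain ⟨l, rfl, hc, hh, hl⟩ := h1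
  refine ⟨l.reverse, by simp, ?_, by simp [hl], by simp [hh]⟩
  rw [List.isChain_reverse]
  exact hc.imp (fun a b h => h.symm)

theorem Pth.mem_left {V : Type} {G : SimpleGraph V} {M : Multiset V} {x y : V}
    (h1 : Pth G M x y) : x ∈ M := by
  obtain ⟨l, rfl, hc, hh, hl⟩ := h1
  exact Multiset.mem_coe.2 (List.mem_of_mem_head? hh)

theorem Pth.mem_right {V : Type} {G : SimpleGraph V} {M : Multiset V} {x y : V}
    (h1 : Pth G M x y) : y ∈ M := h1.symm.mem_left

theorem Pth.mono {V : Type} {G G' : SimpleGraph V} {M : Multiset V} {x y : V}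
    (hG : ∀ a b, G.Adj a b → G'.Adj a b) (h1 : Pth G M x y) : Pth G' M x y := by
  obtain ⟨l, rfl, hc, hh, hl⟩ := h1
  exact ⟨l, rfl, hc.imp (fun a b h => hG a b h), hh, hl⟩

theorem Pth.of_chain {V : Type} {G : SimpleGraph V} {x z : V} {t : List V}
    (hc : (x :: t).IsChain G.Adj) (hz : (x :: t).getLast? = some z) :
    Pth G ((x :: t : List V) : Multiset V) x z :=
  ⟨x :: t, rfl, hc, rfl, hz⟩

/-- Insert a clique at the end of a path. -/
theorem Pth.ins {V : Type} {G : SimpleGraph V} {M : Multiset V} {x y w : V}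
    (h : Pth G M x y) (L : List V) (hL : L.Pairwise G.Adj) (hy : ∀ z ∈ L, G.Adj y z)
    (hw : ∀ z ∈ L, G.Adj z w) (hyw : G.Adj y w) :
    ∃ y', Pth G (M + (L : Multiset V)) x y' ∧ G.Adj y' w := by
  induction L generalizing M y with
  | nil => exact ⟨y, by simpa using h, hyw⟩
  | cons a L ih =>
    have h2 := h.append (Pth.single G a) (hy a (by simp))
    rw [List.pairwise_cons] at hL
    obtain ⟨y', h3, h4⟩ := ih h2 hL.2 hL.1 (fun z hz => hw z (by simp [hz])) (hw a (by simp))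
    refine ⟨y', ?_, h4⟩
    have : M + ((a :: L : List V) : Multiset V) = M + {a} + (L : Multiset V) := by
      rw [← Multiset.cons_coe, ← Multiset.singleton_add]; abel
    rw [this]; exact h3

/-- The graph obtained from `G` by making the vertices satisfying `Hv` a clique. -/
def hgr {V : Type} (G : SimpleGraph V) (Hv : V → Prop) : SimpleGraph V where
  Adj x y := G.Adj x y ∨ (x ≠ y ∧ Hv x ∧ Hv y)
  symm := ⟨fun x y h => by
    rcases h with h | ⟨h1, h2, h3⟩
    · exact Or.inl h.symm
    · exact Or.inr ⟨h1.symm, h3, h2⟩⟩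
  loopless := ⟨fun x h => by
    rcases h with h | ⟨h1, _, _⟩
    · exact G.loopless.irrefl x h
    · exact h1 rfl⟩

theorem hgr_of_adj {V : Type} {G : SimpleGraph V} {Hv : V → Prop} {x y : V} (h : G.Adj x y) :
    (hgr G Hv).Adj x y := Or.inl h

theorem hgr_adj_light {V : Type} {G : SimpleGraph V} {Hv : V → Prop} {x y : V}
    (h : (hgr G Hv).Adj x y) (hy : ¬ Hv y) : G.Adj x y := by
  rcases h with h | ⟨_, _, h⟩
  · exact h
  · exact absurd h hy

/-- `l` lists the vertices `M0` in the cyclic order of a cycle of `G`. -/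
def GC {V : Type} (G : SimpleGraph V) (M0 : Multiset V) (l : List V) : Prop :=
  (l : Multiset V) = M0 ∧ l.IsChain G.Adj ∧ ∀ x ∈ l.head?, ∀ y ∈ l.getLast?, G.Adj y x

theorem GC.rot {V : Type} {G : SimpleGraph V} {M0 : Multiset V} {a b : List V}
    (h : GC G M0 (a ++ b)) : GC G M0 (b ++ a) := by
  obtain ⟨h1, h2, h3⟩ := h
  rcases a with _ | ⟨x, a⟩
  · rw [List.append_nil]; exact ⟨h1, h2, h3⟩
  rcases b with _ | ⟨y, b⟩
  · rw [List.append_nil] at h1 h2 h3; exact ⟨h1, h2, h3⟩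
  rw [List.isChain_append] at h2
  refine ⟨?_, ?_, ?_⟩
  · rw [← h1, ← Multiset.coe_add, ← Multiset.coe_add, add_comm]
  · rw [List.isChain_append]
    refine ⟨h2.2.1, h2.1, ?_⟩
    intro p hp q hq
    apply h3
    · simpa using hq
    · simp only [List.getLast?_append]
      rw [Option.mem_def] at hp
      simp [hp]
  · intro p hp q hq
    apply h2.2.2
    · rw [Option.mem_def] at hq ⊢
      simp only [List.getLast?_append] at hq
      have : ∃ z, (x :: a).getLast? = some z := ⟨_, List.getLast?_eq_some_getLast (by simp)⟩
      obtain ⟨z, hz⟩ := this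
      rw [hz] at hq ⊢
      simpa using hq
    · simpa using hp

/-- The standing assumptions: `M0` is a maximum cycle through all heavy vertices. -/
structure Ctx {V : Type} (G : SimpleGraph V) (Hv : V → Prop) (M0 : Multiset V) : Prop where
  nodup : M0.Nodup
  card3 : 3 ≤ M0.card
  cyc : ∃ l, GC G M0 l
  heavy : ∀ x, Hv x → x ∈ M0
  max : ∀ (M : Multiset V) (x y : V), Pth (hgr G Hv) M x y → (hgr G Hv).Adj y x → M.Nodup →
    (∀ h, Hv h → h ∈ M) → M.card ≤ M0.card
  claw : ∀ c x y z, G.Adj c x → G.Adj c y → G.Adj c z → ¬ Hv z → x ≠ y → x ≠ z → y ≠ z →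
    ¬ G.Adj x z → ¬ G.Adj y z → (hgr G Hv).Adj x y
  p6 : ∀ a b c d e f, G.Adj a b → G.Adj b c → G.Adj c d → G.Adj d e → G.Adj e f →
    ¬ G.Adj a c → ¬ G.Adj a d → ¬ G.Adj a e → ¬ G.Adj a f →
    ¬ G.Adj b d → ¬ G.Adj b e → ¬ G.Adj b f →
    ¬ G.Adj c e → ¬ G.Adj c f → ¬ G.Adj d f →
    (Hv a ∨ Hv c) ∧ (Hv b ∨ Hv d) ∧ (Hv c ∨ Hv e) ∧ (Hv d ∨ Hv f)

theorem Ctx.light {V : Type} {G : SimpleGraph V} {Hv : V → Prop} {M0 : Multiset V}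
    (c : Ctx G Hv M0) {x : V} (hx : x ∉ M0) : ¬ Hv x := fun h => hx (c.heavy x h)

theorem Ctx.noExt {V : Type} {G : SimpleGraph V} {Hv : V → Prop} {M0 : Multiset V}
    (c : Ctx G Hv M0) {M N : Multiset V} {x y : V} (hP : Pth (hgr G Hv) M x y)
    (hyx : (hgr G Hv).Adj y x) (hN : N.Nodup) (hNd : ∀ x ∈ N, x ∉ M0) (hN0 : 0 < N.card)
    (hM : M = M0 + N) : False := by
  subst hM
  have := c.max _ x y hP hyx (by
    rw [Multiset.nodup_add]
    refine ⟨c.nodup, hN, ?_⟩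
    rw [Multiset.disjoint_right]
    exact fun {a} h => hNd a h) (fun h hh => Multiset.mem_add.2 (Or.inl (c.heavy h hh)))
  rw [Multiset.card_add] at this
  omega

theorem last_cons {V : Type} (x : V) (t : List V) : ∃ z, (x :: t).getLast? = some z :=
  ⟨_, List.getLast?_eq_some_getLast (by simp)⟩

theorem GC.nodup {V : Type} {G : SimpleGraph V} {Hv : V → Prop} {M0 : Multiset V} {l : List V}
    (c : Ctx G Hv M0) (h : GC G M0 l) : l.Nodup := by
  have := c.nodup
  rw [← h.1] at this
  simpa using this

theorem GC.len {V : Type} {G : SimpleGraph V} {Hv : V → Prop} {M0 : Multiset V} {l : List V}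
    (c : Ctx G Hv M0) (h : GC G M0 l) : 3 ≤ l.length := by
  have := c.card3
  rw [← h.1] at this
  simpa using this

/-- pieces of the cycle are paths of the closure graph -/
theorem GC.piece {V : Type} {G : SimpleGraph V} (Hv : V → Prop) {M0 : Multiset V}
    {s t r : List V} {x z : V} (h : GC G M0 (s ++ ((x :: t) ++ r)))
    (hz : (x :: t).getLast? = some z) :
    Pth (hgr G Hv) ((x :: t : List V) : Multiset V) x z := by
  have h2 := h.2.1
  rw [List.isChain_append, List.isChain_append] at h2
  exact Pth.of_chain (h2.2.1.1.imp (fun a b h => hgr_of_adj h)) hz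

/-- consecutive vertices are adjacent -/
theorem GC.adj {V : Type} {G : SimpleGraph V} {M0 : Multiset V}
    {s r : List V} {x y : V} (h : GC G M0 (s ++ x :: y :: r)) : G.Adj x y := by
  have h2 := h.2.1
  rw [List.isChain_append_cons_cons] at h2
  exact h2.2.1

theorem GC.adj' {V : Type} {G : SimpleGraph V} {M0 : Multiset V}
    {s t r : List V} {y z : V} (h : GC G M0 (s ++ (t ++ y :: r))) (hz : t.getLast? = some z) :
    G.Adj z y := by
  have h2 := h.2.1
  rw [List.isChain_append, List.isChain_append] at h2
  exact h2.2.1.2.2 z hz y (by simp)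

/-- the last vertex is adjacent to the first -/
theorem GC.close {V : Type} {G : SimpleGraph V} {M0 : Multiset V}
    {l : List V} {x z : V} (h : GC G M0 (x :: l)) (hz : l.getLast? = some z) : G.Adj z x := by
  apply h.2.2 x (by simp) z
  cases l with
  | nil => simp at hz
  | cons a l => simpa using hz

theorem rule1a {V : Type} {G : SimpleGraph V} {Hv : V → Prop} {M0 : Multiset V}
    (c : Ctx G Hv M0) {u x p : V} {t : List V} (h : GC G M0 (u :: x :: t))
    (hp : p ∉ M0) (hpu : (hgr G Hv).Adj p u) : ¬ (hgr G Hv).Adj p x := by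
  intro hpx
  obtain ⟨z, hz⟩ := last_cons x t
  have h1 := GC.piece Hv (s := [u]) (r := []) (x := x) (t := t) (by simpa using h) hz
  have h2 := h.close hz
  have h3 := ((Pth.single _ p).append h1 hpx).append (Pth.single _ u) (hgr_of_adj h2)
  refine c.noExt (N := {p}) h3 hpu.symm (by simp) (by simpa using hp) (by simp) ?_
  rw [← h.1]
  simp only [← Multiset.cons_coe, ← Multiset.singleton_add]
  abel

theorem rule1b {V : Type} {G : SimpleGraph V} {Hv : V → Prop} {M0 : Multiset V}
    (c : Ctx G Hv M0) {u x p : V} {t : List V} (h : GC G M0 (u :: t)) (hx : t.getLast? = some x)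
    (hp : p ∉ M0) (hpu : (hgr G Hv).Adj p u) : ¬ (hgr G Hv).Adj p x := by
  intro hpx
  obtain ⟨t', rfl⟩ := List.getLast?_eq_some_iff.1 hx
  have h' : GC G M0 ((u :: t') ++ [x]) := by simpa using h
  have := h'.rot
  exact rule1a c (by simpa using this) hp hpx hpu

/-- the two cycle neighbours of an attachment vertex are adjacent in the closure -/
theorem ruleR1 {V : Type} {G : SimpleGraph V} {Hv : V → Prop} {M0 : Multiset V}
    (c : Ctx G Hv M0) {u x y p : V} {t : List V} (h : GC G M0 (u :: t))
    (hx : t.head? = some x) (hy : t.getLast? = some y)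
    (hp : p ∉ M0) (hpu : G.Adj p u) : (hgr G Hv).Adj y x := by
  have hlen := GC.len c h
  have hnd := GC.nodup c h
  have hyu := h.close hy
  have n2 := rule1b c h hy hp (hgr_of_adj hpu)
  rcases t with _ | ⟨a, t⟩
  · simp at hx
  simp at hx
  subst hx
  have n1 := rule1a c h hp (hgr_of_adj hpu)
  have hux : G.Adj u a := GC.adj (s := []) h
  have hpM : ∀ b ∈ u :: a :: t, p ≠ b := by
    rintro b hb rfl
    apply hp
    rw [← h.1]
    simpa using hb
  have hyt : y ∈ t := by
    rcases t with _ | ⟨b, t⟩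
    · simp at hlen
    · rw [List.getLast?_cons_cons] at hy
      exact List.mem_of_mem_getLast? hy
  simp only [List.nodup_cons] at hnd
  have hya : y ≠ a := fun e => hnd.2.1 (e ▸ hyt)
  exact c.claw u y a p hyu.symm hux hpu.symm (c.light hp) hya
    (hpM y (by simp [hyt])).symm (hpM a (by simp)).symm
    (fun e => n2 (hgr_of_adj e.symm)) (fun e => n1 (hgr_of_adj e.symm))

/-- a block of neighbours of `u` following `u` can be traversed before `u`, from the
predecessor `z` of `u` -/
theorem blk {V : Type} {G : SimpleGraph V} {Hv : V → Prop} {M0 : Multiset V}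
    (c : Ctx G Hv M0) {u z p : V} {A R : List V} (h : GC G M0 (u :: (A ++ R)))
    (hz : R.getLast? = some z) (hp : p ∉ M0) (hpu : G.Adj p u)
    (hA : ∀ a ∈ A, (hgr G Hv).Adj a u) :
    ∃ x, Pth (hgr G Hv) ((A : Multiset V) + {u}) x u ∧ (hgr G Hv).Adj z x := by
  have hz' : (A ++ R).getLast? = some z := by simp [List.getLast?_append, hz]
  rcases A with _ | ⟨a, A⟩
  · exact ⟨u, by simpa using Pth.single _ u, hgr_of_adj (h.close hz')⟩
  · obtain ⟨b, hb⟩ := last_cons a A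
    have h1 := GC.piece Hv (s := [u]) (r := R) (by simpa using h) hb
    exact ⟨a, h1.append (Pth.single _ u) (hA b (List.mem_of_mem_getLast? hb)),
      ruleR1 c h (by simp) hz' hp hpu⟩

theorem rule1 {V : Type} {G : SimpleGraph V} {Hv : V → Prop} {M0 : Multiset V}
    (c : Ctx G Hv M0) {u x p : V} {A t : List V} (h : GC G M0 (u :: (A ++ x :: t)))
    (hp : p ∉ M0) (hpu : G.Adj p u) (hA : ∀ a ∈ A, (hgr G Hv).Adj a u) :
    ¬ (hgr G Hv).Adj p x := by
  intro hpx
  obtain ⟨z, hz⟩ := last_cons x t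
  have h1 := GC.piece Hv (s := u :: A) (r := []) (x := x) (t := t) (by simpa using h) hz
  obtain ⟨y, h2, h3⟩ := blk c h hz hp hpu hA
  have h4 := ((Pth.single _ p).append h1 hpx).append h2 h3
  refine c.noExt (N := {p}) h4 (hgr_of_adj hpu.symm) (by simp) (by simpa using hp) (by simp) ?_
  rw [← h.1]
  simp only [← Multiset.cons_coe, ← Multiset.coe_add, ← Multiset.singleton_add]
  abel

theorem seg_ne {V : Type} {G : SimpleGraph V} {Hv : V → Prop} {M0 N : Multiset V}
    (c : Ctx G Hv M0) {u v p q : V} {A : List V} (h : GC G M0 (u :: (A ++ [v])))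
    (hP : Pth (hgr G Hv) N p q) (hN : N.Nodup) (hNd : ∀ x ∈ N, x ∉ M0)
    (hpu : G.Adj p u) (hqv : G.Adj q v) : False := by
  have h1 := GC.piece Hv (s := []) (r := []) (x := u) (t := A ++ [v]) (z := v) (by simpa using h)
    (by simp [List.getLast?_cons])
  have h2 := h1.append hP.symm (hgr_of_adj hqv.symm)
  refine c.noExt (N := N) h2 (hgr_of_adj hpu) hN hNd
    (Multiset.card_pos_iff_exists_mem.2 ⟨p, hP.mem_left⟩) ?_
  rw [← h.1]

theorem rule2 {V : Type} {G : SimpleGraph V} {Hv : V → Prop} {M0 N : Multiset V}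
    (c : Ctx G Hv M0) {u v p q x : V} {A A' B : List V}
    (h : GC G M0 (u :: (A ++ x :: A') ++ v :: B))
    (hP : Pth (hgr G Hv) N p q) (hN : N.Nodup) (hNd : ∀ x ∈ N, x ∉ M0)
    (hpu : G.Adj p u) (hqv : G.Adj q v) (hA : ∀ a ∈ A, (hgr G Hv).Adj a u) :
    ¬ (hgr G Hv).Adj x v := by
  intro hxv
  rcases B with _ | ⟨s, B⟩
  · exact seg_ne c (A := A ++ x :: A') (by simpa using h) hP hN hNd hpu hqv
  have hp := hNd p hP.mem_left
  have hq := hNd q hP.mem_right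
  obtain ⟨zu, hzu⟩ := last_cons s B
  obtain ⟨zv, hzv⟩ := last_cons x A'
  have e1 := GC.piece Hv (s := u :: (A ++ x :: A') ++ [v]) (r := []) (x := s) (t := B)
    (by simpa using h) hzu
  have e2 := GC.piece Hv (s := u :: A) (r := v :: s :: B) (x := x) (t := A')
    (by simpa using h) hzv
  obtain ⟨y, e3, e4⟩ := blk c (A := A) (R := (x :: A' ++ [v]) ++ s :: B) (z := zu)
    (by simpa using h) (by rw [List.getLast?_append, hzu]; simp) hp hpu hA
  have h' : GC G M0 (v :: (s :: B ++ (u :: (A ++ x :: A')))) := by simpa using h.rot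
  have e5 : (hgr G Hv).Adj zv s := ruleR1 c h' (by simp)
    (by
      have : s :: B ++ (u :: (A ++ x :: A')) = (s :: B ++ u :: A) ++ x :: A' := by simp
      rw [this, List.getLast?_append, hzv]; simp) hq hqv
  have e6 := (((hP.append (Pth.single _ v) (hgr_of_adj hqv)).append e2 hxv.symm).append e1 e5).append
    e3 e4
  refine c.noExt (N := N) e6 (hgr_of_adj hpu.symm) hN hNd
    (Multiset.card_pos_iff_exists_mem.2 ⟨p, hP.mem_left⟩) ?_
  rw [← h.1]
  simp only [List.cons_append, ← Multiset.cons_coe, ← Multiset.coe_add, ← Multiset.singleton_add]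
  abel

theorem rule3 {V : Type} {G : SimpleGraph V} {Hv : V → Prop} {M0 N : Multiset V}
    (c : Ctx G Hv M0) {u v p q x y : V} {A A' B B' : List V}
    (h : GC G M0 (u :: (A ++ x :: A') ++ v :: (B ++ y :: B')))
    (hP : Pth (hgr G Hv) N p q) (hN : N.Nodup) (hNd : ∀ x ∈ N, x ∉ M0)
    (hpu : G.Adj p u) (hqv : G.Adj q v) (hA : ∀ a ∈ A, (hgr G Hv).Adj a u)
    (hB : ∀ a ∈ B, (hgr G Hv).Adj a v) :
    ¬ (hgr G Hv).Adj x y := by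
  intro hxy
  have hp := hNd p hP.mem_left
  have hq := hNd q hP.mem_right
  obtain ⟨zu, hzu⟩ := last_cons y B'
  obtain ⟨zv, hzv⟩ := last_cons x A'
  have e1 := GC.piece Hv (s := u :: (A ++ x :: A') ++ v :: B) (r := []) (x := y) (t := B')
    (by simpa using h) hzu
  have e2 := GC.piece Hv (s := u :: A) (r := v :: (B ++ y :: B')) (x := x) (t := A')
    (by simpa using h) hzv
  obtain ⟨s, e3, e4⟩ := blk c (A := A) (R := (x :: A' ++ v :: B) ++ y :: B') (z := zu)
    (by simpa using h) (by rw [List.getLast?_append, hzu]; simp) hp hpu hA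
  have h' : GC G M0 (v :: (B ++ y :: B') ++ u :: (A ++ x :: A')) := h.rot
  obtain ⟨t, e5, e6⟩ := blk c (A := B) (R := (y :: B' ++ u :: A) ++ x :: A') (z := zv)
    (by simpa using h') (by rw [List.getLast?_append, hzv]; simp) hq hqv hB
  have e7 := (((hP.append e5.symm (hgr_of_adj hqv)).append e2.symm e6.symm).append e1 hxy).append
    e3 e4
  refine c.noExt (N := N) e7 (hgr_of_adj hpu.symm) hN hNd
    (Multiset.card_pos_iff_exists_mem.2 ⟨p, hP.mem_left⟩) ?_
  rw [← h.1]
  simp only [List.cons_append, ← Multiset.cons_coe, ← Multiset.coe_add, ← Multiset.singleton_add]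
  abel

theorem first_not {α : Type} (P : α → Prop) (l : List α) (h : ∃ x ∈ l, ¬ P x) :
    ∃ l1 x l2, l = l1 ++ x :: l2 ∧ (∀ y ∈ l1, P y) ∧ ¬ P x := by
  induction l with
  | nil => simp at h
  | cons a l ih =>
    by_cases ha : P a
    · obtain ⟨x, hx, hPx⟩ := h
      have : ∃ x ∈ l, ¬ P x := by
        rcases List.mem_cons.1 hx with rfl | hx
        · exact absurd ha hPx
        · exact ⟨x, hx, hPx⟩
      obtain ⟨l1, x, l2, rfl, h1, h2⟩ := ih this
      refine ⟨a :: l1, x, l2, by simp, ?_, h2⟩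
      intro y hy
      rcases List.mem_cons.1 hy with rfl | hy
      · exact ha
      · exact h1 y hy
    · exact ⟨[], a, l, by simp, by simp, ha⟩

theorem frame {V : Type} {G : SimpleGraph V} {Hv : V → Prop} {M0 : Multiset V}
    (c : Ctx G Hv M0) {u v p : V} {A B : List V} (h : GC G M0 (u :: A ++ v :: B))
    (hp : p ∉ M0) (hpu : G.Adj p u) (hpv : G.Adj p v) :
    ∃ A1 a1 a A2, A = A1 ++ a1 :: a :: A2 ∧ (∀ x ∈ A1, G.Adj x u) ∧ G.Adj a1 u ∧ ¬ G.Adj a u := by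
  have hP := Pth.single (hgr G Hv) p
  have hN : ({p} : Multiset V).Nodup := by simp
  have hNd : ∀ x ∈ ({p} : Multiset V), x ∉ M0 := by simpa using hp
  have hr := h.rot
  have hne : A ≠ [] := by
    rintro rfl
    exact seg_ne c (u := v) (A := B) (v := u) (by simpa using hr) hP hN hNd hpv hpu
  have hex : ∃ x ∈ A, ¬ G.Adj x u := by
    by_contra hcon
    push Not at hcon
    obtain ⟨A0, z, rfl⟩ : ∃ A0 z, A = A0 ++ [z] := by
      obtain ⟨A0, z, hA⟩ := List.eq_nil_or_concat A |>.resolve_left hne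
      exact ⟨A0, z, by simpa using hA⟩
    apply rule2 c (A := A0) (x := z) (A' := []) h hP hN hNd hpu hpv
      (fun a ha => hgr_of_adj (hcon a (by simp [ha])))
    exact hgr_of_adj (GC.adj (s := u :: A0) (r := B) (by simpa using h))
  obtain ⟨l1, a, A2, rfl, h1, h2⟩ := first_not _ _ hex
  rcases List.eq_nil_or_concat l1 with rfl | ⟨A1, a1, rfl⟩
  · exact absurd (GC.adj (s := []) (r := A2 ++ v :: B) (by simpa using h)).symm h2
  · simp only [List.mem_append, List.mem_singleton, List.concat_eq_append] at h1
    exact ⟨A1, a1, a, A2, by simp, fun x hx => h1 x (by simp [hx]), h1 a1 (by simp), h2⟩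

theorem hv2 {V : Type} {G : SimpleGraph V} {Hv : V → Prop} {x y : V}
    (h : ¬ (hgr G Hv).Adj x y) (hne : x ≠ y) (hx : Hv x) (hy : Hv y) : False :=
  h (Or.inr ⟨hne, hx, hy⟩)

theorem step2 {V : Type} {G : SimpleGraph V} {Hv : V → Prop} {M0 : Multiset V}
    (c : Ctx G Hv M0) {u v p : V} {A B : List V} (h : GC G M0 (u :: A ++ v :: B))
    (hp : p ∉ M0) (hpu : G.Adj p u) (hpv : G.Adj p v) :
    G.Adj u v ∧ Hv u ∧ Hv v ∧ ∃ B1 d B2, B = B1 ++ d :: B2 ∧ (∀ x ∈ B1, ¬ G.Adj p x) ∧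
      ¬ G.Adj p d ∧ ¬ G.Adj d u ∧ ¬ G.Adj d v := by
  have hP := Pth.single (hgr G Hv) p
  have hN : ({p} : Multiset V).Nodup := by simp
  have hNd : ∀ x ∈ ({p} : Multiset V), x ∉ M0 := by simpa using hp
  have hr := h.rot
  obtain ⟨A1, a1, a, A2, rfl, hA1, ha1, ha⟩ := frame c h hp hpu hpv
  obtain ⟨B1, d1, d, B2, rfl, hB1, hd1, hd⟩ := frame c hr hp hpv hpu
  have hA1' : ∀ x ∈ A1, (hgr G Hv).Adj x u := fun x hx => hgr_of_adj (hA1 x hx)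
  have hB1' : ∀ x ∈ B1, (hgr G Hv).Adj x v := fun x hx => hgr_of_adj (hB1 x hx)
  have hA1'' : ∀ x ∈ A1 ++ [a1], (hgr G Hv).Adj x u := by
    intro x hx
    rcases List.mem_append.1 hx with hx | hx
    · exact hA1' x hx
    · rw [List.mem_singleton.1 hx]; exact hgr_of_adj ha1
  have hB1'' : ∀ x ∈ B1 ++ [d1], (hgr G Hv).Adj x v := by
    intro x hx
    rcases List.mem_append.1 hx with hx | hx
    · exact hB1' x hx
    · rw [List.mem_singleton.1 hx]; exact hgr_of_adj hd1
  have a1v := rule2 c (A := A1) (x := a1) (A' := a :: A2) h hP hN hNd hpu hpv hA1'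
  have av := rule2 c (A := A1 ++ [a1]) (x := a) (A' := A2) (by simpa using h) hP hN hNd hpu hpv hA1''
  have d1u := rule2 c (A := B1) (x := d1) (A' := d :: B2) hr hP hN hNd hpv hpu hB1'
  have du := rule2 c (A := B1 ++ [d1]) (x := d) (A' := B2) (by simpa using hr) hP hN hNd hpv hpu hB1''
  have a1d1 := rule3 c (A := A1) (x := a1) (A' := a :: A2) (B := B1) (y := d1) (B' := d :: B2)
    h hP hN hNd hpu hpv hA1' hB1'
  have a1d := rule3 c (A := A1) (x := a1) (A' := a :: A2) (B := B1 ++ [d1]) (y := d) (B' := B2)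
    (by simpa using h) hP hN hNd hpu hpv hA1' hB1''
  have ad1 := rule3 c (A := A1 ++ [a1]) (x := a) (A' := A2) (B := B1) (y := d1) (B' := d :: B2)
    (by simpa using h) hP hN hNd hpu hpv hA1'' hB1'
  have ad := rule3 c (A := A1 ++ [a1]) (x := a) (A' := A2) (B := B1 ++ [d1]) (y := d) (B' := B2)
    (by simpa using h) hP hN hNd hpu hpv hA1'' hB1''
  have pa1 := rule1 c (A := A1) (x := a1) (t := (a :: A2) ++ v :: (B1 ++ d1 :: d :: B2))
    (by simpa using h) hp hpu hA1'
  have pa := rule1 c (A := A1 ++ [a1]) (x := a) (t := A2 ++ v :: (B1 ++ d1 :: d :: B2))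
    (by simpa using h) hp hpu hA1''
  have pd1 := rule1 c (A := B1) (x := d1) (t := (d :: B2) ++ u :: (A1 ++ a1 :: a :: A2))
    (by simpa using hr) hp hpv hB1'
  have pd := rule1 c (A := B1 ++ [d1]) (x := d) (t := B2 ++ u :: (A1 ++ a1 :: a :: A2))
    (by simpa using hr) hp hpv hB1''
  have pl := c.light hp
  have hlt : ∀ {x y}, ¬ (hgr G Hv).Adj x y → ¬ G.Adj x y := fun hn hh => hn (hgr_of_adj hh)
  have hlt' : ∀ {x y}, ¬ (hgr G Hv).Adj x y → ¬ G.Adj y x := fun hn hh => hn (hgr_of_adj hh.symm)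
  have aa1 : G.Adj a1 a :=
    GC.adj (s := u :: A1) (r := A2 ++ v :: (B1 ++ d1 :: d :: B2)) (by simpa using h)
  have dd1 : G.Adj d1 d :=
    GC.adj (s := v :: B1) (r := B2 ++ u :: (A1 ++ a1 :: a :: A2)) (by simpa using hr)
  have huv : G.Adj u v := by
    by_contra huv
    obtain ⟨-, h1, -, h2⟩ := c.p6 a a1 u p v d1 aa1.symm ha1 hpu.symm hpv hd1.symm ha (hlt' pa)
      (hlt av) (hlt ad1) (hlt' pa1) (hlt a1v) (hlt a1d1) huv (hlt' d1u) (hlt pd1)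
    refine hv2 a1d1 ?_ (h1.resolve_right pl) (h2.resolve_left pl)
    rintro rfl
    exact a1v (hgr_of_adj hd1)
  obtain ⟨h1, h2, h3, h4⟩ := c.p6 a a1 u v d1 d aa1.symm ha1 huv hd1.symm dd1 ha
      (hlt av) (hlt ad1) (hlt ad) (hlt a1v) (hlt a1d1) (hlt a1d) (hlt' d1u) (hlt' du)
      (fun e => hd e.symm)
  refine ⟨huv, ?_, ?_, B1 ++ [d1], d, B2, by simp, ?_, fun e => pd (hgr_of_adj e),
    fun e => du (hgr_of_adj e), hd⟩
  · by_contra hu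
    refine hv2 ad1 ?_ (h1.resolve_right hu) (h3.resolve_left hu)
    rintro rfl
    exact av (hgr_of_adj hd1)
  · by_contra hv
    refine hv2 a1d ?_ (h2.resolve_right hv) (h4.resolve_left hv)
    rintro rfl
    exact du (hgr_of_adj ha1)
  · intro x hx e
    rcases List.mem_append.1 hx with hx | hx
    · obtain ⟨B3, B4, rfl⟩ := List.append_of_mem hx
      exact rule1 c (A := B3) (x := x) (t := B4 ++ d1 :: d :: B2 ++ u :: (A1 ++ a1 :: a :: A2))
        (by simpa using hr) hp hpv (fun a ha => hB1' a (by simp [ha])) (hgr_of_adj e)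
    · rw [List.mem_singleton.1 hx] at e
      exact pd1 (hgr_of_adj e)

theorem Kcl {V : Type} {G : SimpleGraph V} {Hv : V → Prop} {M0 : Multiset V}
    (c : Ctx G Hv M0) {u p x y : V} (hp : p ∉ M0) (hpu : G.Adj p u) (hx : x ∈ M0) (hy : y ∈ M0)
    (hxy : x ≠ y) (hux : G.Adj x u) (huy : G.Adj y u) (hpx : ¬ G.Adj p x) (hpy : ¬ G.Adj p y) :
    (hgr G Hv).Adj x y :=
  c.claw u x y p hux.symm huy.symm hpu.symm (c.light hp) hxy (fun e => hp (e ▸ hx))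
    (fun e => hp (e ▸ hy)) (fun e => hpx e.symm) (fun e => hpy e.symm)

theorem disj {V : Type} {G : SimpleGraph V} {Hv : V → Prop} {M0 : Multiset V}
    (c : Ctx G Hv M0) {u v p x : V} {A B : List V} (h : GC G M0 (u :: A ++ v :: B))
    (hp : p ∉ M0) (hpu : G.Adj p u) (hpv : G.Adj p v) (hx : x ∈ A) (hpx : ¬ G.Adj p x)
    (hxu : G.Adj x u) (hxv : G.Adj x v) : False := by
  have hP := Pth.single (hgr G Hv) p
  have hN : ({p} : Multiset V).Nodup := by simp
  have hNd : ∀ x ∈ ({p} : Multiset V), x ∉ M0 := by simpa using hp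
  have hr := h.rot
  obtain ⟨huv, hu, hv, -⟩ := step2 c h hp hpu hpv
  have hnd := GC.nodup c h
  have hmem : ∀ y ∈ u :: A ++ v :: B, y ∈ M0 := by
    intro y hy
    rw [← h.1]; simpa using hy
  obtain ⟨A', A2, rfl⟩ := List.append_of_mem hx
  rcases B with _ | ⟨b, B⟩
  · exact seg_ne c (A := A' ++ x :: A2) (by simpa using h) hP hN hNd hpu hpv
  rcases A' with _ | ⟨a, A'⟩
  · exact rule2 c (A := []) (x := x) (A' := A2) h hP hN hNd hpu hpv (by simp) (hgr_of_adj hxv)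
  have av := rule2 c (A := []) (x := a) (A' := A' ++ x :: A2) (by simpa using h) hP hN hNd hpu hpv
    (by simp)
  have bu := rule2 c (A := []) (x := b) (A' := B) (by simpa using hr) hP hN hNd hpv hpu
    (by simp)
  have ab := rule3 c (A := []) (x := a) (A' := A' ++ x :: A2) (B := []) (y := b) (B' := B)
    (by simpa using h) hP hN hNd hpu hpv (by simp) (by simp)
  simp only [List.cons_append, List.append_assoc, List.nodup_cons, List.nodup_append,
    List.mem_append, List.mem_cons, not_or, ne_eq] at hnd
  have al : ¬ Hv a := fun e => hv2 av (by tauto) e hv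
  have bl : ¬ Hv b := fun e => hv2 bu (by tauto) e hu
  have pa : ¬ G.Adj p a := fun e => rule1a c (x := a) (by simpa using h) hp (hgr_of_adj hpu)
    (hgr_of_adj e)
  have pb : ¬ G.Adj p b := fun e => rule1a c (x := b) (by simpa using hr) hp (hgr_of_adj hpv)
    (hgr_of_adj e)
  have hau : G.Adj u a := GC.adj (s := []) (r := A' ++ x :: A2 ++ v :: b :: B) (by simpa using h)
  have hbv : G.Adj v b := GC.adj (s := []) (r := B ++ u :: (a :: A' ++ x :: A2)) (by simpa using hr)
  obtain ⟨zu, hzu⟩ := last_cons b B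
  have hzu' : (a :: A' ++ x :: A2 ++ v :: b :: B).getLast? = some zu := by
    simp only [List.getLast?_append, List.getLast?_cons_cons, hzu]; simp
  have hzum : zu ∈ b :: B := List.mem_of_mem_getLast? hzu
  have pzu : ¬ G.Adj p zu := fun e => rule1b c (x := zu) h hzu' hp (hgr_of_adj hpu) (hgr_of_adj e)
  have hzuu : G.Adj zu u := h.close hzu'
  have xa : G.Adj x a := hgr_adj_light (Kcl c hp hpu (hmem x (by simp)) (hmem a (by simp))
    (fun e => by subst e; exact av (hgr_of_adj hxv)) hxu hau.symm hpx pa) al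
  have xb : G.Adj x b := hgr_adj_light (Kcl c hp hpv (hmem x (by simp)) (hmem b (by simp))
    (fun e => by subst e; exact bu (hgr_of_adj hxu)) hxv hbv.symm hpx pb) bl
  have zx : (hgr G Hv).Adj zu x := Kcl c hp hpu (hmem zu (by simp at hzum ⊢; tauto))
    (hmem x (by simp))
    (fun e => by
      subst e
      rcases List.mem_cons.1 hzum with e | e
      · subst e; exact bu (hgr_of_adj hxu)
      · grind) hzuu hxu pzu hpx
  have e1 := GC.piece Hv (s := u :: (a :: A' ++ x :: A2) ++ [v]) (r := []) (x := b) (t := B)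
    (by simpa using h) hzu
  have e2 := GC.piece Hv (s := [u]) (r := A2 ++ v :: b :: B) (x := a) (t := A' ++ [x]) (z := x)
    (by simpa using h) (by simp [List.getLast?_cons])
  have fin : ∀ {M x y}, Pth (hgr G Hv) M x y → (hgr G Hv).Adj y x → M = M0 + {p} → False :=
    fun hh hh' hM => c.noExt hh hh' hN hNd (by simp) hM
  rcases A2 with _ | ⟨d, A2⟩
  · have e3 : (hgr G Hv).Adj zu a := ruleR1 c h (by simp) hzu' hp hpu
    have := (((hP.append (Pth.single _ u) (hgr_of_adj hpu)).append e2.symm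
      (hgr_of_adj hxu.symm)).append e1.symm e3.symm).append (Pth.single _ v) (hgr_of_adj hbv.symm)
    refine fin this (hgr_of_adj hpv.symm) ?_
    rw [← h.1]
    simp only [List.cons_append, ← Multiset.cons_coe, ← Multiset.coe_add, ← Multiset.singleton_add]
    abel
  · obtain ⟨zv, hzv⟩ := last_cons d A2
    have e3 := GC.piece Hv (s := u :: (a :: A' ++ [x])) (r := v :: b :: B) (x := d) (t := A2)
      (by simpa using h) hzv
    have zvv : G.Adj zv v := GC.adj' (s := u :: (a :: A' ++ [x])) (t := d :: A2) (r := b :: B)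
      (by simpa using h) hzv
    have xd : G.Adj x d := GC.adj (s := u :: a :: A') (r := A2 ++ v :: b :: B) (by simpa using h)
    have da : ¬ G.Adj d a := by
      intro hda
      have := ((((hP.append (Pth.single _ v) (hgr_of_adj hpv)).append e3.symm
        (hgr_of_adj zvv.symm)).append e2 (hgr_of_adj hda)).append e1 (hgr_of_adj xb)).append
        (Pth.single _ u) (hgr_of_adj hzuu)
      refine fin this (hgr_of_adj hpu.symm) ?_
      rw [← h.1]
      simp only [List.cons_append, ← Multiset.cons_coe, ← Multiset.coe_add,
        ← Multiset.singleton_add]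
      abel
    have hbd : b ≠ d := by
      rintro rfl
      grind
    have had : d ≠ a := by
      rintro rfl
      have := hnd.2.1
      grind
    have bd := c.claw x b d a xb xd xa al hbd
      (fun e => by subst e; exact bu (hgr_of_adj hau.symm)) had
      (fun e => ab (hgr_of_adj e.symm)) da
    have := ((((hP.append (Pth.single _ v) (hgr_of_adj hpv)).append e3.symm
        (hgr_of_adj zvv.symm)).append e1 bd.symm).append e2.symm zx).append
        (Pth.single _ u) (hgr_of_adj hau.symm)
    refine fin this (hgr_of_adj hpu.symm) ?_
    rw [← h.1]
    simp only [List.cons_append, ← Multiset.cons_coe, ← Multiset.coe_add,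
      ← Multiset.singleton_add]
    abel

/-- the path through the cycle which omits only light vertices of a segment -/
theorem lemL {V : Type} {G : SimpleGraph V} {Hv : V → Prop} {M0 : Multiset V}
    (c : Ctx G Hv M0) {u v p : V} {A1 A2 B T L1 L2 E : List V}
    (h : GC G M0 (u :: (A1 ++ A2) ++ v :: B))
    (hp : p ∉ M0) (hpu : G.Adj p u) (hpv : G.Adj p v)
    (hpA : ∀ x ∈ A1 ++ A2, ¬ G.Adj p x)
    (hA2 : ∀ y ∈ A2.head?, (hgr G Hv).Adj v y)
    (hT : T.Nodup) (hTd : ∀ x ∈ T, x ∉ M0) (hTc : T.Pairwise (hgr G Hv).Adj)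
    (hTu : ∀ x ∈ T, G.Adj u x) (hTv : ∀ x ∈ T, G.Adj x v)
    (hsplit : ((L1 ++ L2 ++ E : List V) : Multiset V) = (A1 : Multiset V))
    (h1 : ∀ x ∈ L1, G.Adj x u) (h2 : ∀ x ∈ L2, G.Adj x v) (hE : ∀ x ∈ E, ¬ Hv x) :
    T.length ≤ E.length := by
  have hP := Pth.single (hgr G Hv) p
  have hN : ({p} : Multiset V).Nodup := by simp
  have hNd : ∀ x ∈ ({p} : Multiset V), x ∉ M0 := by simpa using hp
  have hr := h.rot
  obtain ⟨huv, hu, hv, -⟩ := step2 c h hp hpu hpv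
  have hnd := GC.nodup c h
  have hmem : ∀ y ∈ u :: (A1 ++ A2) ++ v :: B, y ∈ M0 := by
    intro y hy
    rw [← h.1]; simpa using hy
  have hLm : ∀ x, x ∈ L1 ∨ x ∈ L2 ∨ x ∈ E ↔ x ∈ A1 := by
    intro x
    rw [← Multiset.mem_coe, ← Multiset.mem_coe, ← Multiset.mem_coe, ← Multiset.mem_coe, ← hsplit]
    simp
  have hLnd : (L1 ++ L2 ++ E).Nodup := by
    rw [← Multiset.coe_nodup, hsplit, Multiset.coe_nodup]
    simp only [List.cons_append, List.append_assoc, List.nodup_cons, List.nodup_append] at hnd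
    exact hnd.2.1
  rcases B with _ | ⟨b, B⟩
  · exact (seg_ne c (A := A1 ++ A2) (by simpa using h) hP hN hNd hpu hpv).elim
  have pb : ¬ G.Adj p b := fun e => rule1a c (x := b) (by simpa using hr) hp (hgr_of_adj hpv)
    (hgr_of_adj e)
  have hbv : G.Adj v b := GC.adj (s := []) (r := B ++ u :: (A1 ++ A2)) (by simpa using hr)
  obtain ⟨zu, hzu⟩ := last_cons b B
  have hzu' : (A1 ++ A2 ++ v :: b :: B).getLast? = some zu := by
    simp only [List.getLast?_append, List.getLast?_cons_cons, hzu]; simp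
  have hzum : zu ∈ b :: B := List.mem_of_mem_getLast? hzu
  have pzu : ¬ G.Adj p zu := fun e => rule1b c (x := zu) h hzu' hp (hgr_of_adj hpu) (hgr_of_adj e)
  have hzuu : G.Adj zu u := h.close hzu'
  simp only [List.cons_append, List.append_assoc, List.nodup_cons, List.nodup_append,
    List.mem_append, List.mem_cons, not_or, ne_eq] at hnd
  have e1 := GC.piece Hv (s := u :: (A1 ++ A2) ++ [v]) (r := []) (x := b) (t := B)
    (by simpa using h) hzu
  have hL2A : ∀ x ∈ L2, x ∈ A1 := fun x hx => (hLm x).1 (by tauto)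
  have hL1A : ∀ x ∈ L1, x ∈ A1 := fun x hx => (hLm x).1 (by tauto)
  have hQ : ∃ e, Pth (hgr G Hv) ({v} + (A2 : Multiset V)) v e ∧ (hgr G Hv).Adj e b ∧
      ∀ x ∈ L2, (hgr G Hv).Adj e x := by
    rcases A2 with _ | ⟨y, A2⟩
    · exact ⟨v, by simpa using Pth.single _ v, hgr_of_adj hbv, fun x hx => hgr_of_adj (h2 x hx).symm⟩
    · obtain ⟨e, he⟩ := last_cons y A2
      have e2 := GC.piece Hv (s := u :: A1) (r := v :: b :: B) (x := y) (t := A2)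
        (by simpa using h) he
      have hev : G.Adj e v := GC.adj' (s := u :: A1) (t := y :: A2) (r := b :: B)
        (by simpa using h) he
      have hem : e ∈ y :: A2 := List.mem_of_mem_getLast? he
      have pe := hpA e (List.mem_append.2 (Or.inr hem))
      refine ⟨e, (Pth.single _ v).append e2 (hA2 y (by simp)), ?_, ?_⟩
      · refine Kcl c hp hpv (hmem e (by simp at hem ⊢; tauto)) (hmem b (by simp)) ?_ hev hbv.symm pe pb
        rintro rfl
        grind
      · intro x hx
        have hxA := hL2A x hx
        refine Kcl c hp hpv (hmem e (by simp at hem ⊢; tauto)) (hmem x (by simp [hxA])) ?_ hev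
          (h2 x hx) pe (hpA x (by simp [hxA]))
        rintro rfl
        grind
  obtain ⟨e, hq, heb, heL⟩ := hQ
  have hL2b : ∀ x ∈ L2, (hgr G Hv).Adj x b := by
    intro x hx
    have hxA := hL2A x hx
    refine Kcl c hp hpv (hmem x (by simp [hxA])) (hmem b (by simp)) ?_ (h2 x hx) hbv.symm
      (hpA x (by simp [hxA])) pb
    rintro rfl
    grind
  have hL1z : ∀ x ∈ L1, (hgr G Hv).Adj zu x := by
    intro x hx
    have hxA := hL1A x hx
    refine Kcl c hp hpu (hmem zu (by simp at hzum ⊢; tauto)) (hmem x (by simp [hxA])) ?_ hzuu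
      (h1 x hx) pzu (hpA x (by simp [hxA]))
    rintro rfl
    grind
  have hL2c : L2.Pairwise (hgr G Hv).Adj := by
    have : L2.Nodup := by
      simp only [List.nodup_append] at hLnd; exact hLnd.1.2.1
    refine List.Pairwise.imp_of_mem ?_ this
    intro x y hx hy hxy
    have hxA := hL2A x hx
    have hyA := hL2A y hy
    exact Kcl c hp hpv (hmem x (by simp [hxA])) (hmem y (by simp [hyA])) hxy (h2 x hx) (h2 y hy)
      (hpA x (by simp [hxA])) (hpA y (by simp [hyA]))
  have hL1c : L1.Pairwise (hgr G Hv).Adj := by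
    have : L1.Nodup := by
      simp only [List.nodup_append] at hLnd; exact hLnd.1.1
    refine List.Pairwise.imp_of_mem ?_ this
    intro x y hx hy hxy
    have hxA := hL1A x hx
    have hyA := hL1A y hy
    exact Kcl c hp hpu (hmem x (by simp [hxA])) (hmem y (by simp [hyA])) hxy (h1 x hx) (h1 y hy)
      (hpA x (by simp [hxA])) (hpA y (by simp [hyA]))
  obtain ⟨y1, q1, q1'⟩ := hq.ins L2 hL2c heL hL2b heb
  obtain ⟨y2, q2, q2'⟩ := (q1.append e1 q1').ins L1 hL1c hL1z (fun x hx => hgr_of_adj (h1 x hx))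
    (hgr_of_adj hzuu)
  obtain ⟨y3, q3, q3'⟩ := (q2.append (Pth.single _ u) q2').ins T hTc (fun x hx => hgr_of_adj (hTu x hx))
    (fun x hx => hgr_of_adj (hTv x hx)) (hgr_of_adj huv)
  obtain ⟨M, hMe⟩ : ∃ M : Multiset V, M = {v} + (A2 : Multiset V) + (L2 : Multiset V) + ((b :: B : List V) : Multiset V) +
    (L1 : Multiset V) + {u} + (T : Multiset V) := ⟨_, rfl⟩
  rw [← hMe] at q3
  have hM : M + (E : Multiset V) = M0 + (T : Multiset V) := by
    rw [← h.1, hMe]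
    simp only [List.cons_append, ← Multiset.cons_coe, ← Multiset.coe_add,
        ← Multiset.singleton_add] at hsplit ⊢
    rw [← hsplit]
    abel
  have hle : M ≤ M0 + (T : Multiset V) := hM ▸ Multiset.le_add_right _ _
  have hbig : (M0 + (T : Multiset V)).Nodup := by
    rw [Multiset.nodup_add]
    refine ⟨c.nodup, by simpa using hT, ?_⟩
    rw [Multiset.disjoint_right]
    intro a ha
    exact hTd a (by simpa using ha)
  have := c.max M _ _ q3 q3' (Multiset.nodup_of_le hle hbig) (by
    intro x hx
    have h3 : x ∈ M + (E : Multiset V) := by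
      rw [hM]; exact Multiset.mem_add.2 (Or.inl (c.heavy x hx))
    rcases Multiset.mem_add.1 h3 with h3 | h3
    · exact h3
    · exact absurd hx (hE x (by simpa using h3)))
  have hc := congrArg Multiset.card hM
  simp only [Multiset.card_add, Multiset.coe_card] at hc
  omega

theorem countW {α : Type} (W E : α → Bool) (x : α) (L : List α)
    (hc : (x :: L).IsChain (fun a b => W a → E b))
    (hl : ∀ z, (x :: L).getLast? = some z → ¬ W z) :
    (x :: L).countP W ≤ L.countP E := by
  induction L generalizing x with
  | nil =>
    have := hl x (by simp)
    simp [this]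
  | cons y L ih =>
    rw [List.isChain_cons_cons] at hc
    have := ih y hc.2 (fun z hz => hl z (by rw [List.getLast?_cons_cons]; exact hz))
    rw [List.countP_cons (l := y :: L), List.countP_cons (p := E)]
    by_cases hx : W x
    · simp only [hx, hc.1 hx, if_true]; omega
    · simp only [hx]; simp; omega

theorem Ctx.start {V : Type} {G : SimpleGraph V} {Hv : V → Prop} {M0 : Multiset V}
    (c : Ctx G Hv M0) {u : V} (hu : u ∈ M0) : ∃ t, GC G M0 (u :: t) := by
  obtain ⟨l, hl⟩ := c.cyc
  have : u ∈ l := by rw [← hl.1] at hu; simpa using hu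
  obtain ⟨a, b, rfl⟩ := List.append_of_mem this
  exact ⟨b ++ a, by simpa using hl.rot⟩

open Classical in
theorem count_contra {V : Type} [Fintype V] {G : SimpleGraph V} [DecidableRel G.Adj]
    {Hv : V → Prop} {M0 : Multiset V}
    (c : Ctx G Hv M0) (hdeg : ∀ x, Hv x → Fintype.card V ≤ 2 * G.degree x)
    {p u v' : V} (hp : p ∉ M0) (hu : u ∈ M0) (hv' : v' ∈ M0) (huv' : u ≠ v')
    (hpu : G.Adj p u) (hpv' : G.Adj p v') : False := by
  obtain ⟨t, ht⟩ := c.start hu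
  have hvt : v' ∈ t := by
    rw [← ht.1] at hv'
    simp at hv'
    exact hv'.resolve_left huv'.symm
  obtain ⟨A, v, B, rfl, hpA, hpv⟩ := first_not (fun x => ¬ G.Adj p x) t ⟨v', hvt, by simpa using hpv'⟩
  rw [not_not] at hpv
  have h : GC G M0 (u :: A ++ v :: B) := by simpa using ht
  have hP := Pth.single (hgr G Hv) p
  have hN : ({p} : Multiset V).Nodup := by simp
  have hNd : ∀ x ∈ ({p} : Multiset V), x ∉ M0 := by simpa using hp
  have hr := h.rot
  obtain ⟨huv, hhu, hhv, B1, d, B2, rfl, hpB1, hpd, hdu, hdv⟩ := step2 c h hp hpu hpv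
  have hnd := GC.nodup c h
  have hmemiff : ∀ y, y ∈ u :: A ++ v :: (B1 ++ d :: B2) ↔ y ∈ M0 := by
    intro y
    rw [← h.1]; simp
  -- the off-cycle common neighbours
  obtain ⟨T, hTdef⟩ : ∃ T : List V,
      T = (Finset.univ.filter (fun x => x ∉ M0 ∧ G.Adj u x ∧ G.Adj v x)).toList := ⟨_, rfl⟩
  have hTm : ∀ x, x ∈ T ↔ x ∉ M0 ∧ G.Adj u x ∧ G.Adj v x := by
    intro x; rw [hTdef]; simp
  have hTn : T.Nodup := by rw [hTdef]; exact Finset.nodup_toList _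
  have hTc : T.Pairwise (hgr G Hv).Adj := by
    have hAne : ∃ a A', A = a :: A' := by
      rcases A with _ | ⟨a, A'⟩
      · exact (seg_ne c (u := v) (A := B1 ++ d :: B2) (v := u) (by simpa using hr) hP hN hNd
          hpv hpu).elim
      · exact ⟨a, A', rfl⟩
    obtain ⟨a, A', rfl⟩ := hAne
    have av := rule2 c (A := []) (x := a) (A' := A') (by simpa using h) hP hN hNd hpu hpv
      (by simp)
    have hane : a ≠ v := by
      rintro rfl
      simp [List.nodup_append] at hnd
    have al : ¬ Hv a := fun e => hv2 av hane e hhv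
    have hua : G.Adj u a := GC.adj (s := []) (r := A' ++ v :: (B1 ++ d :: B2)) (by simpa using h)
    refine List.Pairwise.imp_of_mem ?_ hTn
    intro x y hx hy hxy
    rw [hTm] at hx hy
    have hrr : ∀ z, z ∉ M0 → G.Adj u z → z ≠ a ∧ ¬ G.Adj z a := by
      intro z hz huz
      refine ⟨?_, fun e => rule1a c (x := a) (by simpa using h) hz (hgr_of_adj huz.symm)
        (hgr_of_adj e)⟩
      rintro rfl
      exact hz ((hmemiff z).1 (by simp))
    exact c.claw u x y a hx.2.1 hy.2.1 hua al hxy (hrr x hx.1 hx.2.1).1 (hrr y hy.1 hy.2.1).1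
      (hrr x hx.1 hx.2.1).2 (hrr y hy.1 hy.2.1).2
  obtain ⟨Eb, hEb⟩ : ∃ Eb : V → Bool, ∀ x, Eb x = true ↔ ¬ G.Adj x u ∧ ¬ G.Adj x v :=
    ⟨fun x => decide (¬ G.Adj x u ∧ ¬ G.Adj x v), fun x => by simp⟩
  obtain ⟨Wb, hWb⟩ : ∃ Wb : V → Bool, ∀ x, Wb x = true ↔ G.Adj p x :=
    ⟨fun x => decide (G.Adj p x), fun x => by simp⟩
  have key1 : ∀ A1 A2, A = A1 ++ A2 → (∀ y ∈ A2.head?, (hgr G Hv).Adj v y) →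
      (∀ x ∈ A1, Eb x → ¬ Hv x) → T.length ≤ (A1.filter Eb).length := by
    rintro A1 A2 rfl hA2 hA1
    refine lemL c (L1 := A1.filter (fun x => decide (G.Adj x u)))
      (L2 := (A1.filter (fun x => ! decide (G.Adj x u))).filter (fun x => ! Eb x))
      (E := A1.filter Eb) h hp hpu hpv hpA hA2 hTn
      (fun x hx => ((hTm x).1 hx).1) hTc (fun x hx => ((hTm x).1 hx).2.1)
      (fun x hx => ((hTm x).1 hx).2.2.symm) ?_ ?_ ?_ ?_
    · rw [Multiset.coe_eq_coe]
      have q1 := List.filter_append_perm (fun x => decide (G.Adj x u)) A1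
      have q2 := List.filter_append_perm Eb (A1.filter (fun x => ! decide (G.Adj x u)))
      have q3 : (A1.filter (fun x => ! decide (G.Adj x u))).filter Eb = A1.filter Eb := by
        rw [List.filter_filter]
        apply List.filter_congr
        intro x _
        have := hEb x
        by_cases hh : Eb x <;> simp [hh] ; simp [hh] at this; exact this.1
      rw [q3] at q2
      rw [List.append_assoc]
      exact ((List.perm_append_comm.trans q2).append_left _).trans q1
    · simp
    · intro x hx
      simp only [List.mem_filter] at hx
      have := hEb x
      simp at hx
      simp [hx] at this
      exact this
    · intro x hx
      rw [List.mem_filter] at hx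
      exact hA1 x hx.1 hx.2
  have key1' : T.length ≤ (A.filter Eb).length := by
    by_cases hex : ∃ x ∈ A, ¬ (Eb x → ¬ Hv x)
    · obtain ⟨A1, y, A2, hA, hA1, hy⟩ := first_not _ _ hex
      push Not at hy
      have := key1 A1 (y :: A2) hA (by
        intro z hz
        simp at hz
        subst hz
        refine Or.inr ⟨?_, hhv, hy.2⟩
        rintro rfl
        rw [hA] at hnd
        simp [List.nodup_append] at hnd) hA1
      rw [hA, List.filter_append, List.length_append]
      omega
    · push Not at hex
      exact key1 A [] (by simp) (by simp) hex
  have key2 : ((B1 ++ d :: B2).filter Wb).length + 1 ≤ ((B1 ++ d :: B2).filter Eb).length := by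
    have k : (d :: B2).countP Wb ≤ B2.countP Eb := by
      apply countW
      · rw [List.isChain_iff_forall_rel_of_append_cons_cons]
        intro a b s r hs ha
        rw [hWb] at ha
        rw [hEb]
        have h3 : GC G M0 (a :: ([] ++ b :: r) ++ u :: (A ++ v :: (B1 ++ s))) := by
          have : GC G M0 ((u :: (A ++ v :: (B1 ++ s))) ++ a :: b :: r) := by
            have h4 := h
            rw [hs] at h4
            simpa using h4
          exact this.rot
        have h4 : GC G M0 (a :: ([] ++ b :: (r ++ u :: A)) ++ v :: (B1 ++ s)) := by
          simpa using h3
        exact ⟨fun e => rule2 c h3 hP hN hNd ha hpu (by simp) (hgr_of_adj e),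
          fun e => rule2 c h4 hP hN hNd ha hpv (by simp) (hgr_of_adj e)⟩
      · intro z hz hW
        rw [hWb] at hW
        refine rule1b c (x := z) (t := A ++ v :: (B1 ++ d :: B2)) (by simpa using h) ?_ hp
          (hgr_of_adj hpu) (hgr_of_adj hW)
        have : A ++ v :: (B1 ++ d :: B2) = (A ++ v :: B1) ++ d :: B2 := by simp
        rw [this, List.getLast?_append, hz]; simp
    have k2 : B1.countP Wb = 0 := by
      rw [List.countP_eq_zero]
      intro x hx hW
      exact hpB1 x hx ((hWb x).1 hW)
    have k3 : Eb d = true := (hEb d).2 ⟨hdu, hdv⟩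
    rw [← List.countP_eq_length_filter, ← List.countP_eq_length_filter, List.countP_append,
      List.countP_append, k2, List.countP_cons (p := Eb), k3]
    simp only [if_true]
    omega
  -- counting
  generalize hB : B1 ++ d :: B2 = B at *
  have n1 := hdeg u hhu
  have n2 := hdeg v hhv
  have c1 := Finset.card_union_add_card_inter (G.neighborFinset u) (G.neighborFinset v)
  rw [G.card_neighborFinset_eq_degree, G.card_neighborFinset_eq_degree] at c1
  have c2 : (G.neighborFinset u ∩ G.neighborFinset v).card ≤ T.length + (B.filter Wb).length := by
    have : G.neighborFinset u ∩ G.neighborFinset v ⊆ (T ++ B.filter Wb).toFinset := by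
      intro x hx
      simp only [Finset.mem_inter, mem_neighborFinset] at hx
      rw [List.mem_toFinset, List.mem_append, List.mem_filter, hTm, hWb]
      by_cases hxM : x ∈ M0
      · right
        rw [← hmemiff] at hxM
        simp only [List.cons_append, List.mem_cons, List.mem_append] at hxM
        have hxu := hx.1.ne'
        have hxv := hx.2.ne'
        rcases hxM with e | e | e | e
        · exact absurd e hxu
        · exact (disj c h hp hpu hpv e (hpA x e) hx.1.symm hx.2.symm).elim
        · exact absurd e hxv
        · refine ⟨e, ?_⟩
          by_contra hpx
          exact disj c hr hp hpv hpu e hpx hx.2.symm hx.1.symm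
      · exact Or.inl ⟨hxM, hx⟩
    refine (Finset.card_le_card this).trans ((List.toFinset_card_le _).trans ?_)
    simp
  have c3 : (G.neighborFinset u ∪ G.neighborFinset v).card +
      ((A.filter Eb).length + (B.filter Eb).length) ≤ Fintype.card V := by
    have hnd2 : (A.filter Eb ++ B.filter Eb).Nodup := by
      rw [← List.filter_append]
      apply List.Nodup.filter
      simp only [List.cons_append, List.nodup_cons, List.nodup_append, List.mem_append,
        List.mem_cons] at hnd ⊢
      grind
    have hcard := List.toFinset_card_of_nodup hnd2
    rw [List.length_append] at hcard
    rw [← hcard, ← Finset.card_union_of_disjoint]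
    · exact Finset.card_le_univ _
    · rw [Finset.disjoint_left]
      intro x hx hx2
      rw [List.mem_toFinset, ← List.filter_append, List.mem_filter, hEb] at hx2
      simp only [Finset.mem_union, mem_neighborFinset] at hx
      rcases hx with hx | hx
      · exact hx2.2.1 hx.symm
      · exact hx2.2.2 hx.symm
  omega

/-- an off-cycle connection between two cycle vertices -/
def Good {V : Type} (G : SimpleGraph V) (M0 : Multiset V) (u v : V) (P : List V) : Prop :=
  u ∈ M0 ∧ v ∈ M0 ∧ u ≠ v ∧ P ≠ [] ∧ P.Nodup ∧ (∀ x ∈ P, x ∉ M0) ∧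
    (u :: (P ++ [v])).IsChain G.Adj

/-- edges between off-cycle vertices -/
def offG {V : Type} (G : SimpleGraph V) (M0 : Multiset V) : SimpleGraph V where
  Adj x y := G.Adj x y ∧ x ∉ M0 ∧ y ∉ M0
  symm := ⟨fun x y h => ⟨h.1.symm, h.2.2, h.2.1⟩⟩
  loopless := ⟨fun x h => G.loopless.irrefl x h.1⟩

theorem off_reach {V : Type} {G : SimpleGraph V} {M0 : Multiset V} {q x : V} (hq : q ∉ M0)
    (h : (offG G M0).Reachable q x) : x ∉ M0 := by
  obtain ⟨w⟩ := h
  induction w with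
  | nil => exact hq
  | cons h _ ih => exact ih h.2.2

theorem exists_attach {V : Type} [Fintype V] {G : SimpleGraph V} {M0 : Multiset V}
    (h2 : TwoConnected G) {q y w0 : V} (hq : q ∉ M0) (hy : y ∈ M0) (hw0 : w0 ∈ M0) (hwy : w0 ≠ y) :
    ∃ w x, w ∈ M0 ∧ w ≠ y ∧ (offG G M0).Reachable q x ∧ G.Adj x w := by
  by_contra hcon
  push Not at hcon
  have hqy : q ≠ y := fun e => hq (e ▸ hy)
  have key : ∀ a b : {u : V | u ≠ y}, (G.induce {u : V | u ≠ y}).Walk a b →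
      (offG G M0).Reachable q a.1 → (offG G M0).Reachable q b.1 := by
    intro a b w
    induction w with
    | nil => exact id
    | @cons a b _ h _ ih =>
      intro ha
      apply ih
      have hab : G.Adj a.1 b.1 := by simpa using h
      have hb : b.1 ∉ M0 := fun hb => hcon b.1 a.1 hb b.2 ha hab
      exact ha.trans (SimpleGraph.Adj.reachable (G := offG G M0) ⟨hab, off_reach hq ha, hb⟩)
  obtain ⟨w⟩ := (h2.2 y).preconnected ⟨q, hqy⟩ ⟨w0, hwy⟩
  exact off_reach hq (key _ _ w (Reachable.refl _)) hw0

theorem exists_good {V : Type} [Fintype V] {G : SimpleGraph V} {M0 : Multiset V}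
    (h2 : TwoConnected G) (hnd : M0.Nodup) (h3 : 3 ≤ M0.card) {q : V} (hq : q ∉ M0) :
    ∃ u v P, Good G M0 u v P := by
  classical
  have hne : ∀ y, ∃ w ∈ M0, w ≠ y := by
    intro y
    by_contra hcon
    push Not at hcon
    have := Multiset.le_iff_subset hnd |>.2 (show M0 ⊆ {y} from fun x hx => by
      rw [Multiset.mem_singleton]; exact hcon x hx)
    have := Multiset.card_le_card this
    simp at this
    omega
  obtain ⟨y, hy, -⟩ := hne q
  obtain ⟨w0, hw0, hw0y⟩ := hne y
  obtain ⟨u, a, hu, -, ha, hau⟩ := exists_attach h2 hq hy hw0 hw0y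
  obtain ⟨w1, hw1, hw1u⟩ := hne u
  obtain ⟨v, b, hv, hvu, hb, hbv⟩ := exists_attach h2 hq hu hw1 hw1u
  obtain ⟨w, hw⟩ := (ha.symm.trans hb).exists_isPath
  refine ⟨u, v, w.support, hu, hv, hvu.symm, by simp, hw.support_nodup, ?_, ?_⟩
  · intro x hx
    exact off_reach hq (ha.trans (w.takeUntil x hx).reachable)
  · have hch := w.isChain_adj_support.imp (S := G.Adj) (fun _ _ h => h.1)
    have : u :: (w.support ++ [v]) = [u] ++ (w.support ++ [v]) := by simp
    rw [this, List.isChain_append, List.isChain_append]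
    refine ⟨by simp, ⟨hch, by simp, ?_⟩, ?_⟩
    · intro x hx z hz
      rw [List.getLast?_eq_some_getLast (by simp)] at hx
      simp at hx hz
      subst hx; subst hz; exact hbv
    · intro x hx z hz
      rw [List.head?_append, List.head?_eq_some_head (by simp)] at hz
      simp at hx hz
      subst hx; subst hz; exact hau.symm

theorem off_contra {V : Type} [Fintype V] {G : SimpleGraph V} [DecidableRel G.Adj]
    {Hv : V → Prop} {M0 : Multiset V} (h2 : TwoConnected G)
    (c : Ctx G Hv M0) (hdeg : ∀ x, Hv x → Fintype.card V ≤ 2 * G.degree x)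
    {q : V} (hq : q ∉ M0) : False := by
  classical
  have hex : ∃ n u v P, Good G M0 u v P ∧ P.length = n := by
    obtain ⟨u, v, P, h⟩ := exists_good h2 c.nodup c.card3 hq
    exact ⟨_, u, v, P, h, rfl⟩
  obtain ⟨u, v, P, hG, hPn⟩ := Nat.find_spec hex
  have hmin : ∀ u' v' P', Good G M0 u' v' P' → P.length ≤ P'.length := by
    intro u' v' P' h
    rw [hPn]
    exact Nat.find_min' hex ⟨u', v', P', h, rfl⟩
  obtain ⟨hu, hv, huv, hne, hnd, hoff, hch⟩ := hG
  obtain ⟨t, ht⟩ := c.start hu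
  have hvt : v ∈ t := by
    rw [← ht.1] at hv
    simp at hv
    exact hv.resolve_left huv.symm
  obtain ⟨A, B, rfl⟩ := List.append_of_mem hvt
  have h : GC G M0 (u :: A ++ v :: B) := by simpa using ht
  have hr := h.rot
  have hmem : ∀ y ∈ u :: A ++ v :: B, y ∈ M0 := by
    intro y hy
    rw [← h.1]; simpa using hy
  rcases P with _ | ⟨p1, P⟩
  · exact hne rfl
  have hp1 : p1 ∉ M0 := hoff p1 (by simp)
  have hup1 : G.Adj u p1 := by
    simp only [List.cons_append, List.isChain_cons_cons] at hch; exact hch.1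
  rcases P with _ | ⟨p2, P⟩
  · simp at hch
    exact count_contra c hdeg hp1 hu hv huv hch.1.symm hch.2
  have hp2 : p2 ∉ M0 := hoff p2 (by simp)
  have hp12 : G.Adj p1 p2 := by
    simp only [List.cons_append, List.isChain_cons_cons] at hch; exact hch.2.1
  -- the path
  obtain ⟨pl, hpl⟩ := last_cons p1 (p2 :: P)
  have hch' := hch
  have e : u :: (p1 :: p2 :: P ++ [v]) = [u] ++ ((p1 :: p2 :: P) ++ [v]) := by simp
  rw [e, List.isChain_append, List.isChain_append] at hch'
  have hP : Pth (hgr G Hv) ((p1 :: p2 :: P : List V) : Multiset V) p1 pl :=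
    Pth.of_chain (hch'.2.1.1.imp (fun a b h => hgr_of_adj h)) hpl
  have hplv : G.Adj pl v := hch'.2.1.2.2 pl hpl v (by simp)
  have hN : ((p1 :: p2 :: P : List V) : Multiset V).Nodup := by simpa using hnd
  have hNd : ∀ x ∈ ((p1 :: p2 :: P : List V) : Multiset V), x ∉ M0 := fun x hx => hoff x (by simpa using hx)
  rcases A with _ | ⟨a, A⟩
  · exact seg_ne c (u := v) (A := B) (v := u) (by simpa using hr) hP.symm hN hNd hplv hup1.symm
  rcases B with _ | ⟨b, B⟩
  · exact seg_ne c (A := a :: A) (by simpa using h) hP hN hNd hup1.symm hplv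
  have av := rule2 c (A := []) (x := a) (A' := A) (by simpa using h) hP hN hNd hup1.symm hplv
    (by simp)
  have bu := rule2 c (A := []) (x := b) (A' := B) (by simpa using hr) hP.symm hN hNd hplv hup1.symm
    (by simp)
  have ab := rule3 c (A := []) (x := a) (A' := A) (B := []) (y := b) (B' := B)
    (by simpa using h) hP hN hNd hup1.symm hplv (by simp) (by simp)
  have hau : G.Adj u a := GC.adj (s := []) (r := A ++ v :: b :: B) (by simpa using h)
  have hbv : G.Adj v b := GC.adj (s := []) (r := B ++ u :: (a :: A)) (by simpa using hr)
  have ham : a ∈ M0 := hmem a (by simp)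
  have hbm : b ∈ M0 := hmem b (by simp)
  have hnd2 := GC.nodup c h
  have hav : a ≠ v := by rintro rfl; simp [List.nodup_append] at hnd2
  have hau' : a ≠ u := hau.ne'
  have hbv' : b ≠ v := hbv.ne'
  have hlt : ∀ {x y}, ¬ (hgr G Hv).Adj x y → ¬ G.Adj x y := fun hn hh => hn (hgr_of_adj hh)
  have hlt' : ∀ {x y}, ¬ (hgr G Hv).Adj x y → ¬ G.Adj y x := fun hn hh => hn (hgr_of_adj hh.symm)
  have p1w : ∀ w ∈ M0, w ≠ u → ¬ G.Adj p1 w := by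
    intro w hw hwu e
    have := hmin u w [p1] ⟨hu, hw, hwu.symm, by simp, by simp, by simpa using hp1,
      by simp [hup1, e]⟩
    simp at this
  have piw : ∀ s x r, p1 :: p2 :: P = s ++ x :: r → s ≠ [] → ∀ w ∈ M0, w ≠ v → ¬ G.Adj x w := by
    intro s x r hs hsne w hw hwv e
    have hsub : (x :: r).Sublist (p1 :: p2 :: P) := by rw [hs]; exact List.sublist_append_right _ _
    have := hmin w v (x :: r) ⟨hw, hv, hwv, by simp, hsub.nodup hnd,
      fun y hy => hoff y (hsub.subset hy), ?_⟩
    · rw [hs] at this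
      have h0 := List.length_pos_iff.2 hsne
      rw [List.length_append] at this
      omega
    · rw [List.cons_append, List.isChain_cons_cons]
      refine ⟨e.symm, ?_⟩
      have h3 := hch'.2.1
      rw [← List.isChain_append, hs, List.append_assoc, List.isChain_append] at h3
      simpa using h3.2.1
  have p1l := c.light hp1
  have huvn : ¬ G.Adj u v := by
    intro e
    refine av (c.claw u a v p1 hau e hup1 p1l hav (fun e => hp1 (e ▸ ham)) (fun e => hp1 (e ▸ hv))
      (fun e => p1w a ham hau' e.symm) (fun e => p1w v hv huv.symm e.symm))
  have hbu' : b ≠ u := by rintro rfl; exact huvn hbv.symm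
  have p2a := piw [p1] p2 P (by simp) (by simp) a ham hav
  have p2u := piw [p1] p2 P (by simp) (by simp) u hu huv
  have p1a := p1w a ham hau'
  rcases P with _ | ⟨p3, P⟩
  · simp at hpl
    subst hpl
    have p2b := piw [p1] p2 [] (by simp) (by simp) b hbm hbv'
    obtain ⟨k1, -, k2, -⟩ := c.p6 a u p1 p2 v b hau.symm hup1 hp12 hplv hbv
      (fun e => p1a e.symm) (fun e => p2a e.symm) (hlt av) (hlt ab) (fun e => p2u e.symm)
      huvn (hlt' bu) (p1w v hv huv.symm) (p1w b hbm hbu') p2b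
    exact hv2 av hav (k1.resolve_right p1l) (k2.resolve_left p1l)
  have hp23 : G.Adj p2 p3 := by
    simp only [List.cons_append, List.isChain_cons_cons] at hch; exact hch.2.2.1
  have p3l := c.light (hoff p3 (by simp))
  have p3a := piw [p1, p2] p3 P (by simp) (by simp) a ham hav
  have p3u := piw [p1, p2] p3 P (by simp) (by simp) u hu huv
  -- shortcuts
  have short : ∀ P', P'.Sublist (p1 :: p2 :: p3 :: P) → P' ≠ [] →
      P'.length < (p1 :: p2 :: p3 :: P).length → ¬ (u :: (P' ++ [v])).IsChain G.Adj := by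
    intro P' hs hn hl hc
    have := hmin u v P' ⟨hu, hv, huv, hn, hs.nodup hnd, fun x hx => hoff x (hs.subset hx), hc⟩
    omega
  have hch3 : (p3 :: (P ++ [v])).IsChain G.Adj := by
    simp only [List.cons_append, List.isChain_cons_cons] at hch; exact hch.2.2.2
  have p13 : ¬ G.Adj p1 p3 := by
    intro e
    refine short (p1 :: p3 :: P) (by simp) (by simp) (by simp) ?_
    simp only [List.cons_append, List.isChain_cons_cons]
    exact ⟨hup1, e, hch3⟩
  have fin : ∀ x, G.Adj p3 x → ¬ G.Adj a x → ¬ G.Adj u x → ¬ G.Adj p1 x → ¬ G.Adj p2 x → False := by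
    intro x h1 h2 h3 h4 h5
    obtain ⟨-, -, k, -⟩ := c.p6 a u p1 p2 p3 x hau.symm hup1 hp12 hp23 h1
      (fun e => p1a e.symm) (fun e => p2a e.symm) (fun e => p3a e.symm) h2 (fun e => p2u e.symm)
      (fun e => p3u e.symm) h3 p13 h4 h5
    rcases k with k | k
    · exact p1l k
    · exact p3l k
  rcases P with _ | ⟨p4, P⟩
  · simp at hch3
    refine fin v hch3 (hlt av) huvn (p1w v hv huv.symm) ?_
    intro e
    refine short [p1, p2] (by simp) (by simp) (by simp) ?_
    simp [hup1, hp12, e]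
  · simp only [List.cons_append, List.isChain_cons_cons] at hch3
    refine fin p4 hch3.1 ?_ ?_ ?_ ?_
    · exact fun e => piw [p1, p2, p3] p4 P (by simp) (by simp) a ham hav e.symm
    · exact fun e => piw [p1, p2, p3] p4 P (by simp) (by simp) u hu huv e.symm
    · intro e
      refine short (p1 :: p4 :: P) ?_ (by simp) (by simp) ?_
      · exact List.Sublist.cons_cons _ ((List.sublist_cons_self _ _).trans (List.sublist_cons_self _ _))
      simp only [List.cons_append, List.isChain_cons_cons]
      exact ⟨hup1, e, hch3.2⟩
    · intro e
      refine short (p1 :: p2 :: p4 :: P) ?_ (by simp) (by simp) ?_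
      · exact List.Sublist.cons_cons _ (List.Sublist.cons_cons _ (List.sublist_cons_self _ _))
      simp only [List.cons_append, List.isChain_cons_cons]
      exact ⟨hup1, hp12, e, hch3.2⟩

theorem dist_two {W : Type} {R : SimpleGraph W} {a b m : W} (hab : a ≠ b) (hn : ¬ R.Adj a b)
    (h1 : R.Adj a m) (h2 : R.Adj m b) : R.dist a b = 2 := by
  have hr : R.Reachable a b := h1.reachable.trans h2.reachable
  have h3 := hr.one_lt_dist_of_ne_of_not_adj hab hn
  have h4 := dist_le (Walk.cons h1 (Walk.cons h2 Walk.nil))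
  simp at h4
  omega

theorem claw_field {V : Type} [Fintype V] {G : SimpleGraph V} [DecidableRel G.Adj]
    (hclaw : FHeavy G claw) (c x y z : V)
    (cx : G.Adj c x) (cy : G.Adj c y) (cz : G.Adj c z)
    (hz : ¬ Fintype.card V ≤ 2 * G.degree z) (hxy : x ≠ y) (hxz : x ≠ z) (hyz : y ≠ z)
    (nxz : ¬ G.Adj x z) (nyz : ¬ G.Adj y z) :
    (hgr G (fun x => Fintype.card V ≤ 2 * G.degree x)).Adj x y := by
  by_cases nxy : G.Adj x y
  · exact Or.inl nxy
  have nyx : ¬ G.Adj y x := fun e => nxy e.symm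
  have nzx : ¬ G.Adj z x := fun e => nxz e.symm
  have nzy : ¬ G.Adj z y := fun e => nyz e.symm
  have hadj : ∀ i j : Fin 4, G.Adj (![c, x, y, z] i) (![c, x, y, z] j) ↔ claw.Adj i j := by
    intro i j
    fin_cases i <;> fin_cases j <;>
      simp [claw, SimpleGraph.fromRel_adj, cx, cy, cz, cx.symm, cy.symm, cz.symm, nxy, nxz, nyz,
        nyx, nzx, nzy]
  let f : claw ↪g G :=
    { toFun := ![c, x, y, z]
      inj' := by
        have := cx.ne; have := cy.ne; have := cz.ne
        intro i j
        fin_cases i <;> fin_cases j <;> simp <;> tauto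
      map_rel_iff' := by
        intro i j
        exact hadj i j }
  have k1 := hclaw f 1 3 (dist_two (m := 0) (by decide) (by simp [claw]) (by simp [claw])
    (by simp [claw]))
  have k2 := hclaw f 2 3 (dist_two (m := 0) (by decide) (by simp [claw]) (by simp [claw])
    (by simp [claw]))
  have f1 : f 1 = x := rfl
  have f2 : f 2 = y := rfl
  have f3 : f 3 = z := rfl
  rw [f1, f3] at k1
  rw [f2, f3] at k2
  refine Or.inr ⟨hxy, ?_, ?_⟩
  · rcases le_total (G.degree x) (G.degree z) with h | h
    · rw [max_eq_right h] at k1; exact absurd k1 hz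
    · rw [max_eq_left h] at k1; exact k1
  · rcases le_total (G.degree y) (G.degree z) with h | h
    · rw [max_eq_right h] at k2; exact absurd k2 hz
    · rw [max_eq_left h] at k2; exact k2

theorem p6_field {V : Type} [Fintype V] {G : SimpleGraph V} [DecidableRel G.Adj]
    (hP6 : FHeavy G (pathGraph 6)) (Hv : V → Prop)
    (hHv : ∀ x, Hv x ↔ Fintype.card V ≤ 2 * G.degree x) (a b c d e f : V)
    (ab : G.Adj a b) (bc : G.Adj b c) (cd : G.Adj c d) (de : G.Adj d e) (ef : G.Adj e f)
    (ac : ¬ G.Adj a c) (ad : ¬ G.Adj a d) (ae : ¬ G.Adj a e) (af : ¬ G.Adj a f)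
    (bd : ¬ G.Adj b d) (be : ¬ G.Adj b e) (bf : ¬ G.Adj b f)
    (ce : ¬ G.Adj c e) (cf : ¬ G.Adj c f) (df : ¬ G.Adj d f) :
    (Hv a ∨ Hv c) ∧ (Hv b ∨ Hv d) ∧ (Hv c ∨ Hv e) ∧ (Hv d ∨ Hv f) := by
  have ca : ¬ G.Adj c a := fun h => ac h.symm
  have da : ¬ G.Adj d a := fun h => ad h.symm
  have ea : ¬ G.Adj e a := fun h => ae h.symm
  have fa : ¬ G.Adj f a := fun h => af h.symm
  have db : ¬ G.Adj d b := fun h => bd h.symm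
  have eb : ¬ G.Adj e b := fun h => be h.symm
  have fb : ¬ G.Adj f b := fun h => bf h.symm
  have ec : ¬ G.Adj e c := fun h => ce h.symm
  have fc : ¬ G.Adj f c := fun h => cf h.symm
  have fd : ¬ G.Adj f d := fun h => df h.symm
  have hadj : ∀ i j : Fin 6, G.Adj (![a, b, c, d, e, f] i) (![a, b, c, d, e, f] j) ↔
      (pathGraph 6).Adj i j := by
    intro i j
    rw [pathGraph_adj]
    fin_cases i <;> fin_cases j <;>
      simp [ab, bc, cd, de, ef, ab.symm, bc.symm, cd.symm, de.symm, ef.symm, ac, ad, ae, af, bd, be,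
        bf, ce, cf, df, ca, da, ea, fa, db, eb, fb, ec, fc, fd]
  have n1 := ab.ne
  have n2 := bc.ne
  have n3 := cd.ne
  have n4 := de.ne
  have n5 := ef.ne
  have n6 : a ≠ c := by rintro rfl; exact ad cd
  have n7 : a ≠ d := by rintro rfl; exact ae de
  have n8 : a ≠ e := by rintro rfl; exact af ef
  have n9 : a ≠ f := by rintro rfl; exact ae ef.symm
  have n10 : b ≠ d := by rintro rfl; exact be de
  have n11 : b ≠ e := by rintro rfl; exact bf ef
  have n12 : b ≠ f := by rintro rfl; exact be ef.symm
  have n13 : c ≠ e := by rintro rfl; exact cf ef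
  have n14 : c ≠ f := by rintro rfl; exact ce ef.symm
  have n15 : d ≠ f := by rintro rfl; exact cf cd
  let F : pathGraph 6 ↪g G :=
    { toFun := ![a, b, c, d, e, f]
      inj' := by
        intro i j
        fin_cases i <;> fin_cases j <;> simp <;> (first | assumption | (apply Ne.symm; assumption))
      map_rel_iff' := by
        intro i j
        exact hadj i j }
  have mx : ∀ x y : V, Fintype.card V ≤ 2 * max (G.degree x) (G.degree y) → Hv x ∨ Hv y := by
    intro x y h
    rw [hHv, hHv]
    rcases le_total (G.degree x) (G.degree y) with h' | h'
    · rw [max_eq_right h'] at h; exact Or.inr h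
    · rw [max_eq_left h'] at h; exact Or.inl h
  refine ⟨mx _ _ (hP6 F 0 2 ?_), mx _ _ (hP6 F 1 3 ?_), mx _ _ (hP6 F 2 4 ?_),
    mx _ _ (hP6 F 3 5 ?_)⟩
  · exact dist_two (m := 1) (by decide) (by simp [pathGraph_adj]) (by simp [pathGraph_adj])
      (by simp [pathGraph_adj])
  · exact dist_two (m := 2) (by decide) (by simp [pathGraph_adj]) (by simp [pathGraph_adj])
      (by simp [pathGraph_adj])
  · exact dist_two (m := 3) (by decide) (by simp [pathGraph_adj]) (by simp [pathGraph_adj])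
      (by simp [pathGraph_adj])
  · exact dist_two (m := 4) (by decide) (by simp [pathGraph_adj]) (by simp [pathGraph_adj])
      (by simp [pathGraph_adj])

theorem finish {V : Type} {G : SimpleGraph V} {l : List V} (hl : GC G (l : Multiset V) l)
    (hnd : l.Nodup) (h3 : 3 ≤ l.length) (hall : ∀ x, x ∈ l) : IsHamiltonianGraph G := by
  rcases l with _ | ⟨x, _ | ⟨a, _ | ⟨b, t⟩⟩⟩
  · simp at h3
  · simp at h3
  · simp at h3
  have hch := hl.2.1
  let p' := Walk.ofSupport (a :: b :: t) (by simp) hch.of_cons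
  have hs : p'.support = a :: b :: t := Walk.support_ofSupport _ _
  obtain ⟨z, hz⟩ : ∃ z, (a :: b :: t).getLast (by simp) = z := ⟨_, rfl⟩
  have hzx : G.Adj z x := hl.close (by rw [← hz]; exact List.getLast?_eq_some_getLast (by simp))
  obtain ⟨p, hps⟩ : ∃ p : G.Walk a z, p.support = a :: b :: t := by
    subst hz
    exact ⟨p', hs⟩
  have hxa : G.Adj x a := hch.rel
  refine ⟨z, Walk.cons hzx (Walk.cons hxa p), ?_, ?_⟩
  · rw [Walk.cons_isCycle_iff, Walk.isPath_def, Walk.support_cons, hps]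
    refine ⟨hnd, ?_⟩
    rw [Walk.edges_cons, List.mem_cons, not_or]
    have hzm : z ∈ b :: t := by
      rw [← hz, List.getLast_cons (by simp)]
      exact List.getLast_mem _
    rw [List.nodup_cons, List.nodup_cons] at hnd
    constructor
    · intro e
      have : z = a := by
        have := hzx.ne
        have := hxa.ne
        rw [Sym2.eq_iff] at e
        grind
      exact hnd.2.1 (this ▸ hzm)
    · intro e
      have := p.snd_mem_support_of_mem_edges e
      rw [hps] at this
      exact hnd.1 this
  · intro w
    have := hall w
    rw [Walk.support_cons, Walk.support_cons, hps]
    exact List.mem_cons_of_mem _ this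

open Classical in
/-- number of consecutive pairs that are not edges -/
noncomputable def nb {V : Type} (G : SimpleGraph V) : List V → ℕ
  | [] => 0
  | [_] => 0
  | x :: y :: r => (if G.Adj x y then 0 else 1) + nb G (y :: r)

theorem nb_append {V : Type} (G : SimpleGraph V) (a b : List V) (x : V) :
    nb G (a ++ x :: b) = nb G (a ++ [x]) + nb G (x :: b) := by
  induction a with
  | nil => simp [nb]
  | cons c a ih =>
    rcases a with _ | ⟨d, a⟩
    · simp [nb]
    · simp only [List.cons_append, nb] at ih ⊢
      rw [ih]; ring

theorem nb_reverse {V : Type} (G : SimpleGraph V) (l : List V) : nb G l.reverse = nb G l := by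
  induction l with
  | nil => simp
  | cons c a ih =>
    rcases a with _ | ⟨d, a⟩
    · simp
    · rw [List.reverse_cons, List.reverse_cons, List.append_assoc]
      show nb G (a.reverse ++ d :: [c]) = _
      rw [nb_append]
      rw [List.reverse_cons] at ih
      rw [ih]
      have e : nb G [d, c] = nb G [c, d] := by
        by_cases h : G.Adj d c
        · simp [nb, h, h.symm]
        · have h' : ¬ G.Adj c d := fun k => h k.symm
          simp [nb, h, h']
      rw [e, add_comm]
      exact (nb_append G [c] a d).symm

theorem nb_pos {V : Type} (G : SimpleGraph V) (l : List V) (h : ¬ l.IsChain G.Adj) :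
    ∃ s a b r, l = s ++ a :: b :: r ∧ ¬ G.Adj a b := by
  rw [List.isChain_iff_forall_rel_of_append_cons_cons] at h
  push Not at h
  obtain ⟨a, b, s, r, e, h⟩ := h
  exact ⟨s, a, b, r, e, h⟩

/-- number of cyclically consecutive pairs that are not edges -/
noncomputable def nc {V : Type} (G : SimpleGraph V) (l : List V) : ℕ := nb G (l ++ l.head?.toList)

theorem nc_rot {V : Type} (G : SimpleGraph V) (a b : List V) : nc G (a ++ b) = nc G (b ++ a) := by
  rcases a with _ | ⟨x, a⟩
  · simp
  rcases b with _ | ⟨y, b⟩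
  · simp
  have e1 : x :: a ++ y :: b ++ [x] = (x :: a) ++ y :: (b ++ [x]) := by simp
  have e2 : y :: b ++ x :: a ++ [y] = (y :: b) ++ x :: (a ++ [y]) := by simp
  unfold nc
  simp only [List.cons_append, List.head?_cons, Option.toList_some] at e1 e2 ⊢
  rw [e1, e2]
  have f1 := nb_append G (x :: a) (b ++ [x]) y
  have f2 := nb_append G (y :: b) (a ++ [y]) x
  simp only [List.cons_append] at f1 f2
  rw [f1, f2, add_comm]

/-- cycles of the closure graph through all heavy vertices -/
def HC {V : Type} (G : SimpleGraph V) (Hv : V → Prop) (l : List V) : Prop :=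
  GC (hgr G Hv) (l : Multiset V) l ∧ l.Nodup ∧ 3 ≤ l.length ∧ ∀ h, Hv h → h ∈ l

theorem HC.rot {V : Type} {G : SimpleGraph V} {Hv : V → Prop} {a b : List V}
    (h : HC G Hv (a ++ b)) : HC G Hv (b ++ a) := by
  obtain ⟨h1, h2, h3, h4⟩ := h
  refine ⟨?_, List.nodup_append_comm.1 h2, by simp at h3 ⊢; omega, fun x hx => ?_⟩
  · have := h1.rot
    rw [← Multiset.coe_add, add_comm, Multiset.coe_add] at this
    exact this
  · have := h4 x hx
    simp at this ⊢; tauto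

theorem HC.gcyc {V : Type} [Fintype V] {G : SimpleGraph V} [DecidableRel G.Adj] {Hv : V → Prop}
    (hdeg : ∀ x, Hv x → Fintype.card V ≤ 2 * G.degree x) {l : List V} (h : HC G Hv l)
    (hmax : ∀ l', HC G Hv l' → l'.length ≤ l.length)
    (hmin : ∀ l', HC G Hv l' → l'.length = l.length → nc G l ≤ nc G l') :
    GC G (l : Multiset V) l := by
  classical
  -- no closing non-edge in any rotation
  have key : ∀ x t y, HC G Hv (x :: t) → (x :: t).length = l.length → nc G (x :: t) = nc G l →
      (x :: t).getLast? = some y → G.Adj y x := by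
    intro x t y hc hlen hnc hy
    by_contra hyx
    obtain ⟨⟨-, hch, hcl⟩, hnd, h3, hH⟩ := hc
    have hyx' := hcl x (by simp) y hy
    have hxy : x ≠ y := hyx'.ne'
    have hHx : Hv x ∧ Hv y := by
      rcases hyx' with e | e
      · exact absurd e hyx
      · exact ⟨e.2.2, e.2.1⟩
    have n1 := hdeg x hHx.1
    have n2 := hdeg y hHx.2
    have off : ∀ z, z ∉ x :: t → G.Adj y z → ¬ G.Adj x z := by
      intro z hz hyz hxz
      have := hmax (x :: t ++ [z]) ⟨⟨rfl, ?_, ?_⟩, ?_, by simp at h3 ⊢; omega, ?_⟩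
      · rw [List.length_append, hlen] at this
        simp at this
      · rw [List.isChain_append]
        refine ⟨hch, by simp, ?_⟩
        intro a ha b hb
        rw [hy] at ha
        simp at ha hb
        subst ha; subst hb; exact hgr_of_adj hyz
      · intro a ha b hb
        simp [List.getLast?_cons] at ha hb
        subst ha; subst hb; exact hgr_of_adj hxz.symm
      · rw [List.nodup_append]
        refine ⟨hnd, by simp, ?_⟩
        intro a ha b hb e
        simp at hb
        subst hb; subst e; exact hz ha
      · intro w hw
        have := hH w hw
        simp at this ⊢; tauto
    have chain : (x :: t).IsChain (fun a b => decide (G.Adj y a) = true →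
        (! decide (G.Adj x b)) = true) := by
      rw [List.isChain_iff_forall_rel_of_append_cons_cons]
      intro a b s r e ha
      simp only [decide_eq_true_eq] at ha
      simp only [Bool.not_eq_true', decide_eq_false_iff_not]
      intro hb
      have hne : y ≠ a := ha.ne
      have hr : (b :: r).getLast? = some y := by
        have : s ++ a :: b :: r = (s ++ [a]) ++ b :: r := by simp
        rw [e, this, List.getLast?_append, List.getLast?_eq_some_getLast (l := b :: r) (by simp)] at hy
        simp only [Option.some_or] at hy
        rw [List.getLast?_eq_some_getLast (by simp)]; exact hy
      have hhd : (s ++ [a]).head? = some x := by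
        rcases s with _ | ⟨s0, s⟩
        · simp at e ⊢; exact e.1.symm
        · simp at e ⊢; exact e.1.symm
      have e' : x :: t = (s ++ [a]) ++ b :: r := by simp [e]
      have hperm : (x :: t).Perm ((s ++ [a]) ++ (b :: r).reverse) := by
        rw [e']
        exact (List.reverse_perm _).symm.append_left _
      have hch2 := hch
      rw [e', List.isChain_append] at hch2
      have hnew : HC G Hv ((s ++ [a]) ++ (b :: r).reverse) := by
        refine ⟨⟨rfl, ?_, ?_⟩, hperm.nodup_iff.1 hnd, by rw [← hperm.length_eq]; exact h3,
          fun w hw => hperm.mem_iff.1 (hH w hw)⟩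
        · rw [List.isChain_append]
          refine ⟨hch2.1, ?_, ?_⟩
          · rw [List.isChain_reverse]
            exact hch2.2.1.imp (fun a b h => h.symm)
          · intro i hi j hj
            rw [List.head?_reverse, hr] at hj
            simp at hi hj
            subst hi; subst hj; exact hgr_of_adj ha.symm
        · intro i hi j hj
          rw [List.head?_append, hhd] at hi
          rw [List.reverse_cons, ← List.append_assoc] at hj
          simp only [List.getLast?_append] at hj
          simp at hi hj
          subst hi; subst hj; exact hgr_of_adj hb.symm
      have hlt := hmin _ hnew (by rw [← hperm.length_eq]; exact hlen)
      rw [← hnc] at hlt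
      obtain ⟨r0, hr0⟩ := List.getLast?_eq_some_iff.1 hr
      have v1 : nc G (x :: t) = nb G (s ++ [a]) + nb G [a, b] + nb G (b :: r) + 1 := by
        have w1 : nc G (x :: t) = nb G (s ++ a :: (b :: r ++ [x])) := by
          unfold nc
          rw [List.head?_cons, e]
          simp
        have w2 : nb G (b :: r ++ [x]) = nb G (b :: r) + nb G [y, x] := by
          rw [hr0, List.append_assoc]
          exact nb_append G r0 [x] y
        have w3 : nb G (a :: (b :: r ++ [x])) = nb G [a, b] + nb G (b :: r ++ [x]) :=
          nb_append G [a] (r ++ [x]) b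
        have w4 : nb G [y, x] = 1 := by simp [nb, hyx]
        rw [w1, nb_append, w3, w2, w4]; ring
      have v2 : nc G ((s ++ [a]) ++ (b :: r).reverse) = nb G (s ++ [a]) + nb G (b :: r) := by
        have w1 : nc G ((s ++ [a]) ++ (b :: r).reverse) =
            nb G (s ++ a :: ((b :: r).reverse ++ [x])) := by
          unfold nc
          rw [List.head?_append, hhd]
          simp
        have w2 : nb G ((b :: r).reverse ++ [x]) = nb G (b :: r) + nb G [b, x] := by
          rw [List.reverse_cons, List.append_assoc, ← nb_reverse G (b :: r), List.reverse_cons]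
          exact nb_append G _ [x] b
        have w3 : nb G (a :: ((b :: r).reverse ++ [x])) =
            nb G [a, y] + nb G ((b :: r).reverse ++ [x]) := by
          rw [hr0, List.reverse_append]
          exact nb_append G [a] (r0.reverse ++ [x]) y
        have w4 : nb G [a, y] = 0 := by simp [nb, ha.symm]
        have w5 : nb G [b, x] = 0 := by simp [nb, hb.symm]
        rw [w1, nb_append, w3, w2, w4, w5]; ring
      omega
    have k := countW (fun a => decide (G.Adj y a)) (fun b => ! decide (G.Adj x b)) x t chain (by
      intro z hz hh
      rw [hy] at hz
      simp at hz hh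
      subst hz
      exact hh.ne rfl)
    have k2 : t.length = t.countP (fun b => decide (G.Adj x b)) +
        t.countP (fun b => ! decide (G.Adj x b)) := by
      rw [List.length_eq_countP_add_countP (fun b => decide (G.Adj x b))]
      congr 1
      apply List.countP_congr
      intro z _
      simp
    have cnt : ∀ (w : V) (L : List V), (G.neighborFinset w ∩ (x :: t).toFinset ⊆ L.toFinset) →
        G.degree w ≤ L.countP (fun b => decide (G.Adj w b)) +
          (G.neighborFinset w \ (x :: t).toFinset).card := by
      intro w L hL
      rw [← G.card_neighborFinset_eq_degree, ← Finset.card_inter_add_card_sdiff _ (x :: t).toFinset]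
      gcongr
      rw [List.countP_eq_length_filter]
      refine le_trans (Finset.card_le_card ?_) (List.toFinset_card_le _)
      intro z hz
      have := hL hz
      simp only [List.mem_toFinset, List.mem_filter] at this ⊢
      refine ⟨this, ?_⟩
      simp only [Finset.mem_inter, mem_neighborFinset] at hz
      simpa using hz.1
    have c1 := cnt y (x :: t) Finset.inter_subset_right
    have c2 := cnt x t (by
      intro z hz
      simp only [Finset.mem_inter, mem_neighborFinset, List.mem_toFinset, List.mem_cons] at hz ⊢
      rcases hz.2 with e | e
      · subst e; exact absurd rfl hz.1.ne
      · exact e)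
    have c3 : (G.neighborFinset y \ (x :: t).toFinset).card +
        (G.neighborFinset x \ (x :: t).toFinset).card + (x :: t).length ≤ Fintype.card V := by
      rw [← List.toFinset_card_of_nodup hnd, ← Finset.card_union_of_disjoint,
        ← Finset.card_union_of_disjoint]
      · exact Finset.card_le_univ _
      · rw [← Finset.union_sdiff_distrib]
        exact Finset.sdiff_disjoint
      · rw [Finset.disjoint_left]
        intro z hz hz2
        simp only [Finset.mem_sdiff, mem_neighborFinset, List.mem_toFinset] at hz hz2
        exact off z hz.2 hz.1 hz2.1
    simp only [List.length_cons] at c3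
    omega
  refine ⟨rfl, ?_, ?_⟩
  · by_contra hn
    obtain ⟨s, a, b, r, e, hab⟩ := nb_pos G l hn
    subst e
    have e : s ++ a :: b :: r = (s ++ [a]) ++ b :: r := by simp
    apply hab
    apply key b (r ++ (s ++ [a])) a
    · have := HC.rot (a := s ++ [a]) (b := b :: r) (by simpa using h)
      simpa using this
    · simp; omega
    · rw [e, nc_rot]; simp
    · simp [List.getLast?_cons]
  · intro x hx y hy
    rcases l with _ | ⟨x', t⟩
    · simp at hx
    · simp at hx
      subst hx
      exact key x' t y h rfl rfl hy

theorem exists_gcyc {V : Type} [Fintype V] {G : SimpleGraph V} [DecidableRel G.Adj] {Hv : V → Prop}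
    (hdeg : ∀ x, Hv x → Fintype.card V ≤ 2 * G.degree x) (hex : ∃ l, HC G Hv l) :
    ∃ l, HC G Hv l ∧ (∀ l', HC G Hv l' → l'.length ≤ l.length) ∧ GC G (l : Multiset V) l := by
  classical
  have hb : ∀ l, HC G Hv l → l.length ≤ Fintype.card V := fun l hl => hl.2.1.length_le_card
  have e1 : ∃ k l, HC G Hv l ∧ l.length + k = Fintype.card V := by
    obtain ⟨l, hl⟩ := hex
    exact ⟨Fintype.card V - l.length, l, hl, by have := hb l hl; omega⟩
  obtain ⟨l1, hl1, hk1⟩ := Nat.find_spec e1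
  have hmax : ∀ l', HC G Hv l' → l'.length ≤ l1.length := by
    intro l' hl'
    have := Nat.find_min' e1 ⟨l', hl', (by have := hb l' hl'; omega :
      l'.length + (Fintype.card V - l'.length) = Fintype.card V)⟩
    have := hb l' hl'
    omega
  have e2 : ∃ k l, HC G Hv l ∧ l.length = l1.length ∧ nc G l = k := ⟨_, l1, hl1, rfl, rfl⟩
  obtain ⟨l, hl, hlen, hk2⟩ := Nat.find_spec e2
  rw [← hlen] at hmax
  refine ⟨l, hl, hmax, hl.gcyc hdeg hmax ?_⟩
  intro l' hl' hlen'
  rw [hk2]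
  exact Nat.find_min' e2 ⟨l', hl', hlen'.trans hlen, rfl⟩

theorem exists_nbr {V : Type} [Fintype V] {G : SimpleGraph V} (h2 : TwoConnected G) (x y : V)
    (hxy : x ≠ y) : ∃ c, c ≠ y ∧ G.Adj x c := by
  classical
  obtain ⟨z, hz⟩ : ∃ z, z ∉ ({x, y} : Finset V) := by
    by_contra hcon
    push Not at hcon
    have h3 : (Finset.univ : Finset V) ⊆ {x, y} := fun z _ => hcon z
    have h4 := Finset.card_le_card h3
    have h5 := Finset.card_le_two (a := x) (b := y)
    have h6 := h2.1
    rw [Finset.card_univ] at h4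
    omega
  simp only [Finset.mem_insert, Finset.mem_singleton, not_or] at hz
  obtain ⟨w⟩ := (h2.2 y).preconnected ⟨x, hxy⟩ ⟨z, hz.2⟩
  rcases w with _ | ⟨h, _⟩
  · exact absurd rfl hz.1
  · rename_i v _
    exact ⟨v.1, v.2, by simpa using h⟩

theorem hc_of_edge {V : Type} [Fintype V] {G : SimpleGraph V} (h2 : TwoConnected G)
    {Hv : V → Prop} {x y : V} (hxy : (hgr G Hv).Adj x y) (hH : ∀ h, Hv h → h = x ∨ h = y) :
    ∃ l, HC G Hv l := by
  classical
  obtain ⟨c, hcy, hxc⟩ := exists_nbr h2 x y hxy.ne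
  obtain ⟨w, hw⟩ := ((h2.2 x).preconnected ⟨y, hxy.ne'⟩ ⟨c, hxc.ne'⟩).exists_isPath
  obtain ⟨L, hL⟩ : ∃ L : List V, L = w.support.map Subtype.val := ⟨_, rfl⟩
  have hLn : L.Nodup := by
    rw [hL]
    exact hw.support_nodup.map Subtype.val_injective
  have hxL : x ∉ L := by
    rw [hL]
    intro h
    obtain ⟨z, -, hz⟩ := List.mem_map.1 h
    exact z.2 hz
  have hLc : L.IsChain (hgr G Hv).Adj := by
    rw [hL, List.isChain_map]
    exact w.isChain_adj_support.imp (fun a b h => hgr_of_adj (by simpa using h))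
  have hhead : L.head? = some y := by
    rw [hL, List.head?_map, List.head?_eq_some_head (by simp)]
    simp
  have hlast : L.getLast? = some c := by
    rw [hL, List.getLast?_map, List.getLast?_eq_some_getLast (by simp)]
    simp
  have hyL : y ∈ L := List.mem_of_mem_head? hhead
  refine ⟨x :: L, ⟨rfl, ?_, ?_⟩, List.nodup_cons.2 ⟨hxL, hLn⟩, ?_, ?_⟩
  · rw [List.isChain_cons]
    refine ⟨?_, hLc⟩
    intro z hz
    rw [hhead] at hz
    simp at hz
    subst hz; exact hxy
  · intro a ha b hb
    simp only [List.getLast?_cons, hlast] at hb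
    simp at ha hb
    subst ha; subst hb; exact hgr_of_adj hxc.symm
  · rcases L with _ | ⟨a, _ | ⟨b, L⟩⟩
    · simp at hhead
    · simp at hhead hlast
      exact absurd (hlast.symm.trans hhead) hcy
    · simp
  · intro h hh
    rcases hH h hh with rfl | rfl
    · simp
    · simp [hyL]

theorem exists_hc {V : Type} [Fintype V] {G : SimpleGraph V} (h2 : TwoConnected G)
    (Hv : V → Prop) : ∃ l, HC G Hv l := by
  classical
  obtain ⟨H, hHd⟩ : ∃ H : Finset V, ∀ x, x ∈ H ↔ Hv x :=
    ⟨Finset.univ.filter Hv, fun x => by simp⟩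
  have nb1 : ∀ x : V, ∃ y, G.Adj x y := by
    intro x
    have : 1 < Fintype.card V := by have := h2.1; omega
    obtain ⟨z, hz⟩ := Fintype.exists_ne_of_one_lt_card this x
    obtain ⟨c, -, hc⟩ := exists_nbr h2 x z hz.symm
    exact ⟨c, hc⟩
  by_cases h3 : 3 ≤ H.card
  · have hpw : H.toList.Pairwise (hgr G Hv).Adj := by
      refine List.Pairwise.imp_of_mem ?_ (Finset.nodup_toList H)
      intro a b ha hb hab
      rw [Finset.mem_toList, hHd] at ha hb
      exact Or.inr ⟨hab, ha, hb⟩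
    refine ⟨H.toList, ⟨rfl, hpw.isChain, ?_⟩, Finset.nodup_toList H, by simpa using h3,
      fun h hh => by rw [Finset.mem_toList, hHd]; exact hh⟩
    intro a ha b hb
    have hla := List.mem_of_mem_head? ha
    have hlb := List.mem_of_mem_getLast? hb
    rw [Finset.mem_toList, hHd] at hla hlb
    refine Or.inr ⟨?_, hlb, hla⟩
    rintro rfl
    have hn := Finset.nodup_toList H
    have hl : 3 ≤ H.toList.length := by simpa using h3
    generalize H.toList = L at *
    rcases L with _ | ⟨c, _ | ⟨d, L⟩⟩
    · simp at hl
    · simp at hl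
    · simp at ha
      subst ha
      rw [List.getLast?_cons_cons] at hb
      exact (List.nodup_cons.1 hn).1 (List.mem_of_mem_getLast? hb)
  · have : H.card = 0 ∨ H.card = 1 ∨ H.card = 2 := by omega
    rcases this with h | h | h
    · have hne : Nonempty V := Fintype.card_pos_iff.1 (by have := h2.1; omega)
      obtain ⟨x⟩ := hne
      obtain ⟨y, hy⟩ := nb1 x
      refine hc_of_edge h2 (hgr_of_adj hy) ?_
      intro z hz
      rw [Finset.card_eq_zero.1 h] at hHd
      exact absurd ((hHd z).2 hz) (by simp)
    · obtain ⟨x, rfl⟩ := Finset.card_eq_one.1 h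
      obtain ⟨y, hy⟩ := nb1 x
      refine hc_of_edge h2 (hgr_of_adj hy) ?_
      intro z hz
      have := (hHd z).2 hz
      simp at this
      exact Or.inl this
    · obtain ⟨x, y, hxy, rfl⟩ := Finset.card_eq_two.1 h
      refine hc_of_edge h2 (x := x) (y := y) (Or.inr ⟨hxy, (hHd x).1 (by simp), (hHd y).1 (by simp)⟩) ?_
      intro z hz
      have := (hHd z).2 hz
      simpa using this

theorem hamiltonian_of_claw_P6_f_heavy {V : Type} [Fintype V] (G : SimpleGraph V)
    [DecidableRel G.Adj] (h2 : TwoConnected G)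
    (hclaw : FHeavy G claw) (hP6 : FHeavy G (pathGraph 6)) :
    IsHamiltonianGraph G := by
  obtain ⟨l, hl, hmax, hgc⟩ := exists_gcyc (G := G)
    (Hv := fun x => Fintype.card V ≤ 2 * G.degree x) (fun _ h => h) (exists_hc h2 _)
  have c : Ctx G (fun x => Fintype.card V ≤ 2 * G.degree x) (l : Multiset V) :=
    { nodup := by simpa using hl.2.1
      card3 := by simpa using hl.2.2.1
      cyc := ⟨l, hgc⟩
      heavy := fun x hx => by simpa using hl.2.2.2 x hx
      max := by
        rintro M x y ⟨L, rfl, hc, hh, hlast⟩ hyx hnd hH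
        by_cases h3 : 3 ≤ L.length
        · have := hmax L ⟨⟨rfl, hc, ?_⟩, by simpa using hnd, h3, fun h hx => by simpa using hH h hx⟩
          · simpa using this
          · intro a ha b hb
            rw [hh] at ha; rw [hlast] at hb
            simp at ha hb
            subst ha; subst hb; exact hyx
        · have := hl.2.2.1
          simp only [Multiset.coe_card]
          omega
      claw := fun c x y z h1 h2 h3 h4 h5 h6 h7 h8 h9 => claw_field hclaw c x y z h1 h2 h3 h4 h5 h6 h7 h8 h9
      p6 := p6_field hP6 _ (fun x => Iff.rfl) }
  refine finish hgc hl.2.1 hl.2.2.1 ?_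
  intro x
  by_contra hx
  exact off_contra h2 c (fun _ h => h) (q := x) (by simpa using hx)
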